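/- Suppose an isosceles triangle ABC is N-tiled by a tile one of whose angles is a right angle. Then N is a perfect square, or a sum of two perfect squares, or six times a perfect square. -/

import Mathlib

open EuclideanGeometry Real

noncomputable section

/-- A point of the Euclidean plane. -/
abbrev Pt : Type := EuclideanSpace ℝ (Fin 2)

/-- A triangle, given by its three vertices. -/
abbrev Tri : Type := Fin 3 → Pt

/-- A genuine (nondegenerate) triangle. -/
def IsTriangle (T : Tri) : Prop := AffineIndependent ℝ T

/-- The closed triangle (convex hull of the vertices). -/
def triSet (T : Tri) : Set Pt := convexHull ℝ (Set.range T)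

/-- Two triangles are congruent iff corresponding distances agree
up to a permutation of the vertices. -/
def CongruentTri (T₁ T₂ : Tri) : Prop :=
  ∃ σ : Equiv.Perm (Fin 3), ∀ i j : Fin 3, dist (T₁ i) (T₁ j) = dist (T₂ (σ i)) (T₂ (σ j))

/-- An `N`-tiling of the triangle `ABC` by the tile `T`: a family of `N` triangles,
each congruent to `T`, with pairwise disjoint interiors, whose union is the
closed triangle `ABC`. -/
structure IsTiling (N : ℕ) (ABC T : Tri) (tiles : Fin N → Tri) : Prop where
  congr : ∀ i, CongruentTri (tiles i) T
  disj : ∀ i j, i ≠ j → interior (triSet (tiles i)) ∩ interior (triSet (tiles j)) = ∅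
  cover : (⋃ i, triSet (tiles i)) = triSet ABC

/-- The interior angle of the triangle `T` at its `k`-th vertex. -/
def triAngle (T : Tri) (k : Fin 3) : ℝ := ∠ (T (k + 1)) (T k) (T (k + 2))

/-- The side of `T` opposite to the `k`-th vertex. -/
def sideLen (T : Tri) (k : Fin 3) : ℝ := dist (T (k + 1)) (T (k + 2))

/-- `T` has angles `α`, `β`, `γ` (at vertices `0`, `1`, `2`, which are opposite
the sides of lengths `a`, `b`, `c` respectively). -/
def HasAngles (T : Tri) (α β γ : ℝ) : Prop :=
  triAngle T 0 = α ∧ triAngle T 1 = β ∧ triAngle T 2 = γ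

/-- Two triangles are similar iff corresponding distances agree up to a
permutation of the vertices and a positive scale factor. -/
def SimilarTri (T₁ T₂ : Tri) : Prop :=
  ∃ r : ℝ, 0 < r ∧ ∃ σ : Equiv.Perm (Fin 3),
    ∀ i j : Fin 3, dist (T₁ i) (T₁ j) = r * dist (T₂ (σ i)) (T₂ (σ j))

/-- A triangle is isosceles if two of its sides have equal length. -/
def IsIsosceles (T : Tri) : Prop :=
  dist (T 0) (T 1) = dist (T 0) (T 2) ∨ dist (T 0) (T 1) = dist (T 1) (T 2) ∨
    dist (T 0) (T 2) = dist (T 1) (T 2)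

section
open EuclideanGeometry Real

/-- cross product -/
def cr (u v : Pt) : ℝ := u 0 * v 1 - u 1 * v 0

/-- twice the signed area -/
def ar (T : Tri) : ℝ := cr (T 1 - T 0) (T 2 - T 0)

lemma ar_ne_zero (T : Tri) (h : IsTriangle T) : ar T ≠ 0 := by
  intro h0
  unfold IsTriangle at h
  rw [affineIndependent_iff_not_collinear] at h
  apply h
  have h01 : T 1 - T 0 ≠ 0 := by
    intro h1
    have h1' : T 1 = T 0 := sub_eq_zero.mp h1
    have := h
    apply h
    have : Set.range T = {T 0, T 2} := by
      ext z; simp only [Set.mem_range, Set.mem_insert_iff, Set.mem_singleton_iff]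
      constructor
      · rintro ⟨i, rfl⟩
        fin_cases i <;> simp [h1']
      · rintro (h | h)
        · exact ⟨0, h.symm⟩
        · exact ⟨2, h.symm⟩
    rw [this]; exact collinear_pair ℝ _ _
  rw [collinear_iff_of_mem (p₀ := T 0) (Set.mem_range_self 0)]
  refine ⟨T 1 - T 0, ?_⟩
  set u := T 1 - T 0 with hu
  set v := T 2 - T 0 with hv
  have key : ∃ r : ℝ, v = r • u := by
    have h2 : u 0 ^ 2 + u 1 ^ 2 ≠ 0 := by
      intro h3
      apply h01
      have h4 : u 0 = 0 := by nlinarith [sq_nonneg (u 0), sq_nonneg (u 1)]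
      have h5 : u 1 = 0 := by nlinarith [sq_nonneg (u 0), sq_nonneg (u 1)]
      ext i; fin_cases i <;> simp [h4, h5]
    have h0' : u 0 * v 1 - u 1 * v 0 = 0 := h0
    refine ⟨(u 0 * v 0 + u 1 * v 1) / (u 0 ^ 2 + u 1 ^ 2), ?_⟩
    ext i
    fin_cases i
    · simp only [Fin.zero_eta, PiLp.smul_apply, smul_eq_mul]
      field_simp
      linear_combination (-u 1) * h0'
    · simp only [Fin.mk_one, PiLp.smul_apply, smul_eq_mul]
      field_simp
      linear_combination (u 0) * h0'
  rintro p ⟨i, rfl⟩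
  fin_cases i
  · exact ⟨0, by simp⟩
  · exact ⟨1, by simp [hu]⟩
  · obtain ⟨r, hr⟩ := key
    exact ⟨r, by simp [← hr, hv]⟩

lemma mem_triSet (T : Tri) (h : ar T ≠ 0) (z : Pt) :
    z ∈ triSet T ↔ ∀ k : Fin 3, 0 ≤ ar T * cr (T (k+1) - T k) (z - T k) := by
  unfold triSet
  constructor
  · intro hz
    have : convexHull ℝ (Set.range T) ⊆
        {z | ∀ k : Fin 3, 0 ≤ ar T * cr (T (k+1) - T k) (z - T k)} := by
      apply convexHull_min
      · rintro _ ⟨i, rfl⟩ k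
        have e : cr (T (k+1) - T k) (T i - T k) = 0 ∨ cr (T (k+1) - T k) (T i - T k) = ar T := by
          fin_cases k <;> fin_cases i <;> simp [ar, cr] <;> first | (left; ring1) | (right; ring1)
        rcases e with e | e <;> rw [e]
        · simp
        · exact mul_self_nonneg _
      · intro x hx y hy s t hs ht hst k
        have h1 := hx k
        have h2 := hy k
        have : cr (T (k+1) - T k) (s • x + t • y - T k) =
          s * cr (T (k+1) - T k) (x - T k) + t * cr (T (k+1) - T k) (y - T k) := by
          simp only [cr, PiLp.sub_apply, PiLp.add_apply, PiLp.smul_apply, smul_eq_mul]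
          have : t = 1 - s := by linarith
          subst this; ring
        rw [this]
        have := mul_nonneg hs h1
        have := mul_nonneg ht h2
        nlinarith
    exact this hz
  · intro hz
    have h0 := hz 0
    have h1 := hz 1
    have h2 := hz 2
    have ha : 0 < ar T * ar T := mul_self_pos.mpr h
    let w : Fin 3 → ℝ := fun k => (ar T * cr (T (k+1+1) - T (k+1)) (z - T (k+1))) / (ar T * ar T)
    have hw : ∀ k, 0 ≤ w k := fun k => div_nonneg (hz (k+1)) ha.le
    have hs : ∑ k, w k = 1 := by
      simp only [Fin.sum_univ_three, w]
      rw [← add_div, ← add_div, div_eq_one_iff_eq ha.ne']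
      simp [ar, cr]; ring
    have hzz : z = ∑ k, w k • T k := by
      ext i
      simp only [Fin.sum_univ_three, w, PiLp.add_apply, PiLp.smul_apply, smul_eq_mul]
      fin_cases i <;>
      · field_simp
        simp [ar, cr]; ring
    rw [hzz]
    exact (convex_convexHull ℝ _).sum_mem (fun k _ => hw k) hs
      (fun k _ => subset_convexHull ℝ _ ⟨k, rfl⟩)

end

section
open EuclideanGeometry Real

open Filter Topology in
lemma oneD_jump {E : Type*} (s : Finset E) (c p q : E → ℝ) (F : Set ℝ) (hF : F.Finite)
    (h : ∀ t ∉ F, ∑ e ∈ s, c e * ((if p e < t then (1:ℝ) else 0) - (if q e < t then 1 else 0)) = 0)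
    (v : ℝ) : ∑ e ∈ s, c e * ((if p e = v then (1:ℝ) else 0) - (if q e = v then 1 else 0)) = 0 := by
  have hFr : ∀ᶠ t in 𝓝[>] v, t ∉ F := by
    have : (F \ {v})ᶜ ∈ 𝓝 v := (hF.subset Set.sdiff_subset).isClosed.isOpen_compl.mem_nhds (by simp)
    filter_upwards [nhdsWithin_le_nhds this, self_mem_nhdsWithin] with t ht h1 h2
    exact ht ⟨h2, ne_of_gt h1⟩
  have hFl : ∀ᶠ t in 𝓝[<] v, t ∉ F := by
    have : (F \ {v})ᶜ ∈ 𝓝 v := (hF.subset Set.sdiff_subset).isClosed.isOpen_compl.mem_nhds (by simp)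
    filter_upwards [nhdsWithin_le_nhds this, self_mem_nhdsWithin] with t ht h1 h2
    exact ht ⟨h2, ne_of_lt h1⟩
  have hr : ∀ x : ℝ, ∀ᶠ t in 𝓝[>] v, (x < t ↔ x ≤ v) := by
    intro x
    rcases le_or_gt x v with hx | hx
    · filter_upwards [self_mem_nhdsWithin] with t ht
      exact ⟨fun _ => hx, fun _ => lt_of_le_of_lt hx ht⟩
    · filter_upwards [nhdsWithin_le_nhds (Iio_mem_nhds hx)] with t ht
      exact ⟨fun h => absurd h (not_lt.mpr (le_of_lt ht)), fun h => absurd h (not_le.mpr hx)⟩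
  have hl : ∀ x : ℝ, ∀ᶠ t in 𝓝[<] v, (x < t ↔ x < v) := by
    intro x
    rcases lt_or_ge x v with hx | hx
    · filter_upwards [nhdsWithin_le_nhds (Ioi_mem_nhds hx)] with t ht
      exact ⟨fun _ => hx, fun _ => ht⟩
    · filter_upwards [self_mem_nhdsWithin] with t ht
      exact ⟨fun h => lt_trans h ht, fun h => absurd h (not_lt.mpr hx)⟩
  obtain ⟨t, ht, htp, htq⟩ := (hFr.and (((Finset.eventually_all s).mpr (fun e _ => hr (p e))).and
    ((Finset.eventually_all s).mpr (fun e _ => hr (q e))))).exists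
  obtain ⟨u, hu, hup, huq⟩ := (hFl.and (((Finset.eventually_all s).mpr (fun e _ => hl (p e))).and
    ((Finset.eventually_all s).mpr (fun e _ => hl (q e))))).exists
  have h1 := h t ht
  have h2 := h u hu
  have h3 := sub_eq_zero.mpr (h1.trans h2.symm)
  rw [← Finset.sum_sub_distrib] at h3
  refine Eq.trans ?_ h3
  apply Finset.sum_congr rfl
  intro e he
  have a1 := htp e he
  have a2 := htq e he
  have a3 := hup e he
  have a4 := huq e he
  have key : ∀ x : ℝ, (if x = v then (1:ℝ) else 0) =
      (if x ≤ v then (1:ℝ) else 0) - (if x < v then (1:ℝ) else 0) := by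
    intro x
    rcases lt_trichotomy x v with hx | hx | hx
    · simp [hx, hx.ne, hx.le]
    · simp [hx]
    · simp [hx, hx.ne', not_lt.mpr hx.le]
  simp only [a1, a2, a3, a4, key]
  ring

lemma oneD {E : Type*} (s : Finset E) (c p q : E → ℝ) (H : ℝ → ℝ) (F : Set ℝ) (hF : F.Finite)
    (h : ∀ t ∉ F, ∑ e ∈ s, c e * ((if p e < t then (1:ℝ) else 0) - (if q e < t then 1 else 0)) = 0) :
    ∑ e ∈ s, c e * (H (q e) - H (p e)) = 0 := by
  classical
  have J := oneD_jump s c p q F hF h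
  let W := s.image p ∪ s.image q
  have e1 : ∀ e ∈ s, c e * (H (q e) - H (p e)) =
      ∑ v ∈ W, -(c e * ((if p e = v then (1:ℝ) else 0) - (if q e = v then 1 else 0))) * H v := by
    intro e he
    have hp : p e ∈ W := Finset.mem_union_left _ (Finset.mem_image_of_mem _ he)
    have hq : q e ∈ W := Finset.mem_union_right _ (Finset.mem_image_of_mem _ he)
    have : ∀ v ∈ W, -(c e * ((if p e = v then (1:ℝ) else 0) - (if q e = v then 1 else 0))) * H v
      = (if q e = v then c e * H v else 0) - (if p e = v then c e * H v else 0) := by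
      intro v _
      split_ifs <;> ring
    rw [Finset.sum_congr rfl this, Finset.sum_sub_distrib, Finset.sum_ite_eq, Finset.sum_ite_eq,
      if_pos hp, if_pos hq]
    ring
  rw [Finset.sum_congr rfl e1, Finset.sum_comm]
  apply Finset.sum_eq_zero
  intro v _
  rw [← Finset.sum_mul, Finset.sum_neg_distrib, J v]
  simp

end

section
open EuclideanGeometry Real

lemma cr_add_right (u v w : Pt) : cr u (v + w) = cr u v + cr u w := by
  simp [cr]; ring
lemma cr_smul_right (u v : Pt) (t : ℝ) : cr u (t • v) = t * cr u v := by
  simp [cr]; ring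
lemma cr_smul_left (u v : Pt) (t : ℝ) : cr (t • u) v = t * cr u v := by
  simp [cr]; ring

/-- rotation by a right angle -/
def rot (d : Pt) : Pt := !₂[-(d 1), d 0]

lemma cr_rot (d : Pt) : cr d (rot d) = d 0 ^ 2 + d 1 ^ 2 := by
  simp [cr, rot]; ring

lemma normSq_pos (d : Pt) (h : d ≠ 0) : 0 < d 0 ^ 2 + d 1 ^ 2 := by
  by_contra h3
  apply h
  have h4 : d 0 = 0 := by nlinarith [sq_nonneg (d 0), sq_nonneg (d 1)]
  have h5 : d 1 = 0 := by nlinarith [sq_nonneg (d 0), sq_nonneg (d 1)]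
  ext i; fin_cases i <;> simp [h4, h5]

lemma cr_eq_zero_iff (d v : Pt) (h : d ≠ 0) : cr d v = 0 ↔ ∃ t : ℝ, v = t • d := by
  have h2 := normSq_pos d h
  constructor
  · intro h0
    have h0' : d 0 * v 1 - d 1 * v 0 = 0 := h0
    refine ⟨(d 0 * v 0 + d 1 * v 1) / (d 0 ^ 2 + d 1 ^ 2), ?_⟩
    ext i
    fin_cases i
    · simp only [Fin.zero_eta, PiLp.smul_apply, smul_eq_mul]
      field_simp
      linear_combination (-d 1) * h0'
    · simp only [Fin.mk_one, PiLp.smul_apply, smul_eq_mul]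
      field_simp
      linear_combination (d 0) * h0'
  · rintro ⟨t, rfl⟩
    simp [cr]; ring

lemma ar_cyc (T : Tri) (k : Fin 3) : cr (T (k+1) - T k) (T (k+2) - T k) = ar T := by
  fin_cases k <;> simp [ar, cr] <;> ring

lemma edge_ne (T : Tri) (h : ar T ≠ 0) (k : Fin 3) : T (k+1) - T k ≠ 0 := by
  intro h0
  apply h
  rw [← ar_cyc T k, h0]; simp [cr]

/-- value of the edge function -/
def ef (T : Tri) (k : Fin 3) (z : Pt) : ℝ := cr (T (k+1) - T k) (z - T k)

lemma mem_iff_of_ne (T : Tri) (h : ar T ≠ 0) (z : Pt) (hz : ∀ k, ef T k z ≠ 0) :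
    z ∈ triSet T ↔ ∀ k, SignType.sign (ef T k z) = SignType.sign (ar T) := by
  rw [mem_triSet T h]
  apply forall_congr'
  intro k
  have h1 := hz k
  change 0 ≤ ar T * ef T k z ↔ _
  rcases lt_or_gt_of_ne h with h2 | h2 <;> rcases lt_or_gt_of_ne h1 with h3 | h3
  · simp [sign_neg h2, sign_neg h3, (mul_pos_of_neg_of_neg h2 h3).le]
  · simp [sign_neg h2, sign_pos h3, mul_neg_of_neg_of_pos h2 h3]
  · simp [sign_pos h2, sign_neg h3, mul_neg_of_pos_of_neg h2 h3]
  · simp [sign_pos h2, sign_pos h3, (mul_pos h2 h3).le]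

/-- local jump across the line o + t d -/
lemma local_jump (T : Tri) (h : ar T ≠ 0) (o d : Pt) (hd : d ≠ 0) (t δ : ℝ) (hδ : 0 < δ)
    (p : Fin 3 → ℝ)
    (on : Fin 3 → Prop) [DecidablePred on]
    (hon : ∀ k, on k → T k = o + p k • d ∧ T (k+1) = o + p (k+1) • d)
    (hne : ∀ k, p k ≠ t)
    (hoff : ∀ k, ¬ on k → ef T k (o + t • d) ≠ 0 ∧
      SignType.sign (ef T k (o + t • d + δ • rot d)) = SignType.sign (ef T k (o + t • d)) ∧
      SignType.sign (ef T k (o + t • d - δ • rot d)) = SignType.sign (ef T k (o + t • d))) :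
    (open Classical in
    (if (o + t • d + δ • rot d) ∈ triSet T then (1:ℝ) else 0) -
      (if (o + t • d - δ • rot d) ∈ triSet T then (1:ℝ) else 0)) =
    (SignType.sign (ar T) : ℝ) * ∑ k, (if on k then
      ((if p k < t then (1:ℝ) else 0) - (if p (k+1) < t then 1 else 0)) else 0) := by
  set n := rot d
  set z := o + t • d
  have hnn : 0 < cr d n := by rw [cr_rot]; exact normSq_pos d hd
  -- values on edges on the line
  have honv : ∀ k, on k → ∀ x : ℝ, ef T k (z + x • n) = x * (p (k+1) - p k) * cr d n := by
    intro k hk x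
    obtain ⟨h1, h2⟩ := hon k hk
    have e1 : T (k+1) - T k = (p (k+1) - p k) • d := by rw [h1, h2]; module
    have e2 : z + x • n - T k = (t - p k) • d + x • n := by rw [h1]; simp only [z]; module
    unfold ef
    rw [e1, e2, cr_smul_left, cr_add_right, cr_smul_right, cr_smul_right]
    have : cr d d = 0 := by simp [cr]; ring
    rw [this]; ring
  have hpne : ∀ k, on k → p (k+1) - p k ≠ 0 := by
    intro k hk h0
    obtain ⟨h1, h2⟩ := hon k hk
    apply edge_ne T h k
    rw [h1, h2]
    have : p (k+1) = p k := by linarith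
    rw [this]; simp
  have hplus : ∀ k, ef T k (z + δ • n) ≠ 0 := by
    intro k
    by_cases hk : on k
    · rw [honv k hk]; exact mul_ne_zero (mul_ne_zero hδ.ne' (hpne k hk)) hnn.ne'
    · obtain ⟨h1, h2, h3⟩ := hoff k hk
      intro h0; rw [h0] at h2; simp at h2; exact h1 (sign_eq_zero_iff.mp h2.symm)
  have hminus : ∀ k, ef T k (z - δ • n) ≠ 0 := by
    intro k
    by_cases hk : on k
    · have := honv k hk (-δ)
      rw [neg_smul, ← sub_eq_add_neg] at this
      rw [this]; exact mul_ne_zero (mul_ne_zero (neg_ne_zero.mpr hδ.ne') (hpne k hk)) hnn.ne'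
    · obtain ⟨h1, h2, h3⟩ := hoff k hk
      intro h0; rw [h0] at h3; simp at h3; exact h1 (sign_eq_zero_iff.mp h3.symm)
  rw [mem_iff_of_ne T h _ hplus, mem_iff_of_ne T h _ hminus] 
  by_cases hex : ∃ k, on k
  · obtain ⟨k, hk⟩ := hex
    obtain ⟨h1, h2⟩ := hon k hk
    set κ := cr d (T (k+2) - T k) with hκ
    have har : ar T = (p (k+1) - p k) * κ := by
      rw [← ar_cyc T k, hκ, ← cr_smul_left]; congr 1; rw [h1, h2]; module
    have hκ0 : κ ≠ 0 := by rintro h0; apply h; rw [har, h0, mul_zero]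
    have hn1 : ¬ on (k+1) := by
      intro h3
      obtain ⟨h4, h5⟩ := hon _ h3
      apply hκ0
      rw [hκ, cr_eq_zero_iff _ _ hd]
      refine ⟨p (k+1+1) - p k, ?_⟩
      rw [h1, show k + 2 = k + 1 + 1 by fin_cases k <;> rfl, h5]; module
    have hn2 : ¬ on (k+2) := by
      intro h3
      obtain ⟨h4, h5⟩ := hon _ h3
      apply hκ0
      rw [hκ, cr_eq_zero_iff _ _ hd]
      refine ⟨p (k+2) - p k, ?_⟩
      rw [h1, h4]; module
    have e0 : ∀ f : Fin 3 → ℝ, ∑ j, f j = f k + f (k+1) + f (k+2) := by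
      intro f; fin_cases k <;> simp [Fin.sum_univ_three] <;> ring
    have a0 : ∀ f : Fin 3 → Prop, (∀ j, f j) ↔ (f k ∧ f (k+1) ∧ f (k+2)) := by
      intro f
      constructor
      · intro hh; exact ⟨hh _, hh _, hh _⟩
      · rintro ⟨x, y, z⟩ j
        fin_cases k <;> fin_cases j <;> simp_all
    have f1 : ef T (k+1) z = (p (k+1) - t) * κ := by
      have : z - T (k+1) = (t - p (k+1)) • d := by rw [h2]; simp only [z]; module
      unfold ef
      rw [this, cr_smul_right, hκ, h2, h1, show k + 1 + 1 = k + 2 by fin_cases k <;> rfl]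
      simp [cr]; ring
    have f2 : ef T (k+2) z = (t - p k) * κ := by
      have : z - T (k+2) = (t - p k) • d - (T (k+2) - T k) := by rw [h1]; simp only [z]; module
      have h3 : k + 2 + 1 = k := by fin_cases k <;> rfl
      unfold ef
      rw [this, h3, hκ, h1]
      simp [cr]; ring
    have fp := honv k hk δ
    have fm := honv k hk (-δ)
    rw [neg_smul, ← sub_eq_add_neg] at fm
    obtain ⟨_, g1, g2⟩ := hoff _ hn1
    obtain ⟨_, g3, g4⟩ := hoff _ hn2
    rw [e0]
    simp only [a0, g1, g2, g3, g4, fp, fm, f1, f2, har, if_pos hk, if_neg hn1, if_neg hn2,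
      sign_mul, sign_pos hδ, sign_pos hnn, Left.sign_neg]
    have q1 := hne k
    have q2 := hne (k+1)
    have q3 := hpne k hk
    have s1 : p (k+1) - t ≠ 0 := sub_ne_zero.mpr q2
    have s2 : t - p k ≠ 0 := sub_ne_zero.mpr q1.symm
    have r1 : (p k < t) ↔ 0 < t - p k := sub_pos.symm
    have r2 : (p (k+1) < t) ↔ p (k+1) - t < 0 := sub_neg.symm
    simp only [r1, r2]
    rcases lt_or_gt_of_ne q3 with w1 | w1 <;> rcases lt_or_gt_of_ne s1 with w2 | w2 <;>
    rcases lt_or_gt_of_ne s2 with w3 | w3 <;> rcases lt_or_gt_of_ne hκ0 with w4 | w4 <;>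
    first
    | (exfalso; linarith)
    | (simp [sign_neg, sign_pos, w1, w2, w3, w4, not_lt.mpr w2.le, not_lt.mpr w3.le])
  · push Not at hex
    have : ∀ k, SignType.sign (ef T k (z + δ • n)) = SignType.sign (ef T k z) ∧
      SignType.sign (ef T k (z - δ • n)) = SignType.sign (ef T k z) := fun k => (hoff k (hex k)).2
    simp [this, hex]

end

section
open EuclideanGeometry Real
open scoped Topology

lemma ev_sign (A B : ℝ) (hA : A ≠ 0) :
    ∀ᶠ x in 𝓝 (0:ℝ), SignType.sign (A + x * B) = SignType.sign A := by
  have hc : Filter.Tendsto (fun x : ℝ => A + x * B) (𝓝 0) (𝓝 A) := by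
    have : Continuous (fun x : ℝ => A + x * B) := by fun_prop
    have h := this.tendsto 0
    simpa using h
  rcases lt_or_gt_of_ne hA with h | h
  · filter_upwards [hc.eventually_lt_const h] with x hx
    rw [sign_neg h, sign_neg hx]
  · filter_upwards [hc.eventually_const_lt h] with x hx
    rw [sign_pos h, sign_pos hx]

lemma ef_add (T : Tri) (k : Fin 3) (z n : Pt) (x : ℝ) :
    ef T k (z + x • n) = ef T k z + x * cr (T (k+1) - T k) n := by
  simp [ef, cr]; ring

lemma ef_sub (T : Tri) (k : Fin 3) (z n : Pt) (x : ℝ) :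
    ef T k (z - x • n) = ef T k z + (-x) * cr (T (k+1) - T k) n := by
  simp [ef, cr]; ring

/-- coordinate along a line -/
def lc (o d z : Pt) : ℝ := (d 0 * (z 0 - o 0) + d 1 * (z 1 - o 1)) / (d 0 ^ 2 + d 1 ^ 2)

lemma lc_spec (o d z : Pt) (hd : d ≠ 0) (h : cr d (z - o) = 0) : z = o + lc o d z • d := by
  obtain ⟨t, ht⟩ := (cr_eq_zero_iff d _ hd).mp h
  have hp := normSq_pos d hd
  have : z = o + t • d := by rw [← ht]; abel
  have e : lc o d z = t := by
    rw [this]; simp [lc]; field_simp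
  rw [e]; exact this

lemma off_sub (T : Tri) (h : ar T ≠ 0) (k : Fin 3) (o d : Pt) 
    (hoff : ¬ (cr d (T k - o) = 0 ∧ cr d (T (k+1) - o) = 0)) :
    {t : ℝ | ef T k (o + t • d) = 0}.Subsingleton := by
  intro t ht t' ht'
  simp only [Set.mem_ofPred_eq] at ht ht'
  by_contra hne
  apply hoff
  rw [ef_add] at ht ht'
  have he := edge_ne T h k
  have h1 : cr (T (k+1) - T k) d = 0 := by
    have : (t - t') * cr (T (k+1) - T k) d = 0 := by linarith
    exact (mul_eq_zero.mp this).resolve_left (sub_ne_zero.mpr hne)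
  have h2 : cr (T (k+1) - T k) (o - T k) = 0 := by
    rw [h1] at ht; unfold ef at ht; linarith
  obtain ⟨r, hr⟩ := (cr_eq_zero_iff _ _ he).mp h1
  obtain ⟨s, hs⟩ := (cr_eq_zero_iff _ _ he).mp h2
  have e1 : T k - o = (-s) • (T (k+1) - T k) := by rw [neg_smul, ← hs]; abel
  have e2 : T (k+1) - o = (1-s) • (T (k+1) - T k) := by rw [sub_smul, ← hs, one_smul]; abel
  constructor
  · rw [e1]; nth_rw 1 [hr]; simp [cr]; ring
  · rw [e2]; nth_rw 1 [hr]; simp [cr]; ring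

lemma ef_on_ne (T : Tri) (h : ar T ≠ 0) (k : Fin 3) (o d : Pt) (hd : d ≠ 0)
    (hon : cr d (T k - o) = 0 ∧ cr d (T (k+1) - o) = 0) (t x : ℝ) (hx : x ≠ 0) :
    ef T k (o + t • d + x • rot d) ≠ 0 := by
  have h1 := lc_spec o d _ hd hon.1
  have h2 := lc_spec o d _ hd hon.2
  set a := lc o d (T k)
  set b := lc o d (T (k+1))
  have hab : b - a ≠ 0 := by
    intro h0
    apply edge_ne T h k
    rw [h1, h2, show b = a by linarith]; simp
  have : ef T k (o + t • d + x • rot d) = x * (b - a) * (d 0 ^ 2 + d 1 ^ 2) := by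
    unfold ef; rw [h1, h2]; simp [cr, rot]; ring
  rw [this]
  exact mul_ne_zero (mul_ne_zero hx hab) (normSq_pos d hd).ne'

open Classical in
lemma AL_line {J : Type*} [Fintype J] (T : J → Tri) (w : J → ℝ) (har : ∀ j, ar (T j) ≠ 0)
    (hw : ∀ z, (∀ j k, ef (T j) k z ≠ 0) →
      ∑ j, w j * (if z ∈ triSet (T j) then (1:ℝ) else 0) = 0)
    (g : Pt → Pt → ℝ) (hg : ∀ P Q R, cr (Q - P) (R - P) = 0 → g P Q + g Q R = g P R)
    (o d : Pt) (hd : d ≠ 0) :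
    ∑ e : J × Fin 3, (if cr d (T e.1 e.2 - o) = 0 ∧ cr d (T e.1 (e.2+1) - o) = 0 then
      w e.1 * (SignType.sign (ar (T e.1)) : ℝ) * g (T e.1 e.2) (T e.1 (e.2+1)) else 0) = 0 := by
  set on : J → Fin 3 → Prop := fun j k => cr d (T j k - o) = 0 ∧ cr d (T j (k+1) - o) = 0 with hon
  let p : J → Fin 3 → ℝ := fun j k => lc o d (T j k)
  let H : ℝ → ℝ := fun t => g o (o + t • d)
  let c : J × Fin 3 → ℝ := fun e => if on e.1 e.2 then w e.1 * (SignType.sign (ar (T e.1)) : ℝ) else 0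
  let F : Set ℝ := (⋃ e : J × Fin 3, {p e.1 e.2}) ∪
    ⋃ e : J × Fin 3, {t | ¬ on e.1 e.2 ∧ ef (T e.1) e.2 (o + t • d) = 0}
  have hF : F.Finite := by
    apply Set.Finite.union
    · exact Set.finite_iUnion fun e => Set.finite_singleton _
    · apply Set.finite_iUnion
      intro e
      by_cases he : on e.1 e.2
      · simp [he]
      · exact ((off_sub (T e.1) (har _) e.2 o d he).anti (fun t ht => ht.2)).finite
  have key := oneD Finset.univ c (fun e => p e.1 e.2) (fun e => p e.1 (e.2+1)) H F hF ?_
  · refine Eq.trans ?_ key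
    apply Finset.sum_congr rfl
    intro e _
    by_cases he : on e.1 e.2
    · have he' := he
      simp only [hon] at he'
      rw [if_pos he']
      simp only [c, if_pos he]
      congr 1
      have h1 := lc_spec o d _ hd he'.1
      have h2 := lc_spec o d _ hd he'.2
      have := hg o (T e.1 e.2) (T e.1 (e.2+1)) (by rw [h1, h2]; simp [cr]; ring)
      simp only [H, p]
      rw [← h1, ← h2]; linarith
    · have he' := he
      simp only [hon] at he'
      rw [if_neg he']
      simp only [c, if_neg he, zero_mul]
  · intro t ht
    simp only [F, Set.mem_union, Set.mem_iUnion, not_or, not_exists, Set.mem_singleton_iff,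
      Set.mem_ofPred_eq, not_and] at ht
    obtain ⟨ht1, ht2⟩ := ht
    set z := o + t • d with hz
    have ev : ∀ᶠ x in 𝓝[>] (0:ℝ), 0 < x ∧ ∀ e : J × Fin 3, ¬ on e.1 e.2 →
        SignType.sign (ef (T e.1) e.2 (z + x • rot d)) = SignType.sign (ef (T e.1) e.2 z) ∧
        SignType.sign (ef (T e.1) e.2 (z - x • rot d)) = SignType.sign (ef (T e.1) e.2 z) := by
      apply Filter.Eventually.and (eventually_mem_nhdsWithin)
      refine Filter.Eventually.filter_mono nhdsWithin_le_nhds ?_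
      rw [Filter.eventually_all]
      intro e
      by_cases he : on e.1 e.2
      · simp [he]
      · have h0 := ht2 e he
        have a1 := ev_sign _ (cr (T e.1 (e.2+1) - T e.1 e.2) (rot d)) h0
        have a2 := ev_sign _ (-cr (T e.1 (e.2+1) - T e.1 e.2) (rot d)) h0
        filter_upwards [a1, a2] with x b1 b2 _
        rw [ef_add, ef_sub]
        refine ⟨b1, ?_⟩
        rw [← b2]; congr 1; ring
    obtain ⟨x, hx, hx2⟩ := ev.exists
    have lj : ∀ j, _ := fun j => local_jump (T j) (har j) o d hd t x hx (p j) (on j)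
      (fun k hk => ⟨lc_spec o d _ hd hk.1, lc_spec o d _ hd hk.2⟩)
      (fun k hk => ht1 (j,k) hk.symm) (fun k hk => ⟨ht2 (j,k) hk, hx2 (j,k) hk⟩)
    have w1 := hw (z + x • rot d) (by
      intro j k
      by_cases hk : on j k
      · exact ef_on_ne (T j) (har j) k o d hd hk t x hx.ne'
      · intro h0
        have := (hx2 (j,k) hk).1
        simp only at this
        rw [h0, _root_.sign_zero] at this
        exact ht2 (j,k) hk (sign_eq_zero_iff.mp this.symm))
    have w2 := hw (z - x • rot d) (by
      intro j k
      by_cases hk : on j k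
      · have := ef_on_ne (T j) (har j) k o d hd hk t (-x) (neg_ne_zero.mpr hx.ne')
        rwa [neg_smul, ← sub_eq_add_neg] at this
      · intro h0
        have := (hx2 (j,k) hk).2
        simp only at this
        rw [h0, _root_.sign_zero] at this
        exact ht2 (j,k) hk (sign_eq_zero_iff.mp this.symm))
    have w3 : ∑ j, w j * ((if z + x • rot d ∈ triSet (T j) then (1:ℝ) else 0) -
        (if z - x • rot d ∈ triSet (T j) then (1:ℝ) else 0)) = 0 := by
      simp only [mul_sub, Finset.sum_sub_distrib, w1, w2, sub_zero]
    refine Eq.trans ?_ w3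
    rw [Fintype.sum_prod_type]
    apply Finset.sum_congr rfl
    intro j _
    have := lj j
    simp only [← hz] at this
    rw [this, Finset.mul_sum, Finset.mul_sum]
    apply Finset.sum_congr rfl
    intro k _
    by_cases hk : on j k
    · simp only [c, if_pos hk]; ring
    · simp only [c, if_neg hk]; ring

lemma line_eq_iff (T S : Tri) (hT : ar T ≠ 0) (hS : ar S ≠ 0) (k l : Fin 3) :
    {z | ef T k z = 0} = {z | ef S l z = 0} ↔
      (cr (S (l+1) - S l) (T k - S l) = 0 ∧ cr (S (l+1) - S l) (T (k+1) - S l) = 0) := by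
  constructor
  · intro h
    have h1 : T k ∈ {z | ef T k z = 0} := by simp [ef, cr]
    have h2 : T (k+1) ∈ {z | ef T k z = 0} := by simp [ef, cr]; ring
    rw [h] at h1 h2
    exact ⟨h1, h2⟩
  · rintro ⟨h1, h2⟩
    have hd := edge_ne S hS l
    have e1 := lc_spec _ _ _ hd h1
    have e2 := lc_spec _ _ _ hd h2
    set a := lc (S l) (S (l+1) - S l) (T k)
    set b := lc (S l) (S (l+1) - S l) (T (k+1))
    have hab : b - a ≠ 0 := by
      intro h0
      apply edge_ne T hT k
      rw [e1, e2, show b = a by linarith]; simp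
    ext z
    simp only [Set.mem_ofPred_eq]
    have : ef T k z = (b - a) * ef S l z := by
      unfold ef; rw [e1, e2]; simp [cr]; ring
    rw [this]; simp [hab]

open Classical in
lemma AL {J : Type*} [Fintype J] (T : J → Tri) (w : J → ℝ) (har : ∀ j, ar (T j) ≠ 0)
    (hw : ∀ z, (∀ j k, ef (T j) k z ≠ 0) →
      ∑ j, w j * (if z ∈ triSet (T j) then (1:ℝ) else 0) = 0)
    (g : Pt → Pt → ℝ) (hg : ∀ P Q R, cr (Q - P) (R - P) = 0 → g P Q + g Q R = g P R) :
    ∑ j, w j * (SignType.sign (ar (T j)) : ℝ) * ∑ k, g (T j k) (T j (k+1)) = 0 := by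
  let Ln : J × Fin 3 → Set Pt := fun e => {z | ef (T e.1) e.2 z = 0}
  have : ∑ j, w j * (SignType.sign (ar (T j)) : ℝ) * ∑ k, g (T j k) (T j (k+1)) =
    ∑ e : J × Fin 3, w e.1 * (SignType.sign (ar (T e.1)) : ℝ) * g (T e.1 e.2) (T e.1 (e.2+1)) := by
    rw [Fintype.sum_prod_type]; simp only [Finset.mul_sum]
  rw [this, ← Finset.sum_fiberwise_of_maps_to (s := Finset.univ) (t := Finset.univ.image Ln) (g := Ln)
    (fun e _ => Finset.mem_image_of_mem _ (Finset.mem_univ _))]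
  apply Finset.sum_eq_zero
  intro ℓ hℓ
  obtain ⟨e0, -, rfl⟩ := Finset.mem_image.mp hℓ
  rw [Finset.sum_filter]
  refine Eq.trans ?_ (AL_line T w har hw g hg (T e0.1 e0.2) (T e0.1 (e0.2+1) - T e0.1 e0.2) (edge_ne _ (har _) _))
  apply Finset.sum_congr rfl
  intro e _
  have := line_eq_iff (T e.1) (T e0.1) (har _) (har _) e.2 e0.2
  simp only [Ln, this]

end

section
open EuclideanGeometry Real
open scoped Topology

/-- squared length -/
def nsq (v : Pt) : ℝ := v 0 ^ 2 + v 1 ^ 2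
/-- dot product -/
def dt (u v : Pt) : ℝ := u 0 * v 0 + u 1 * v 1
/-- side lengths of the tile -/
def ls (a b : ℝ) : Fin 3 → ℝ := ![1, a, b]

/-- normalised tiling -/
structure Good (N : ℕ) (ABC : Tri) (τ : Fin N → Tri) (a b : ℝ) : Prop where
  arpos : 0 < ar ABC
  apos : 0 < a
  bpos : 0 < b
  sq : a ^ 2 + b ^ 2 = 1
  len : ∀ i k, nsq (τ i (k+1) - τ i k) = (ls a b k) ^ 2
  disj : ∀ i j, i ≠ j → interior (triSet (τ i)) ∩ interior (triSet (τ j)) = ∅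
  cover : (⋃ i, triSet (τ i)) = triSet ABC
  iso : nsq (ABC 1 - ABC 0) = nsq (ABC 2 - ABC 0)

variable {N : ℕ} {ABC : Tri} {τ : Fin N → Tri} {a b : ℝ}

lemma Good.ar_sq (h : Good N ABC τ a b) (i : Fin N) : (ar (τ i)) ^ 2 = (a * b) ^ 2 := by
  have h0 := h.len i 0
  have h1 := h.len i 1
  have h2 := h.len i 2
  have hs := h.sq
  simp [nsq, ls] at h0 h1 h2
  simp only [ar, cr, PiLp.sub_apply]
  set T := τ i
  have hdot : (T 0 0 - T 2 0) * (T 1 0 - T 2 0) + (T 0 1 - T 2 1) * (T 1 1 - T 2 1) = 0 := by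
    linear_combination (-1/2) * h0 + (1/2)*h1 + (1/2)*h2 + (1/2) * hs
  have e : (a*b)^2 = a^2*b^2 := by ring
  rw [e, ← h1, ← h2]
  linear_combination (- ((T 0 0 - T 2 0) * (T 1 0 - T 2 0) + (T 0 1 - T 2 1) * (T 1 1 - T 2 1))) * hdot

lemma Good.ar_abs (h : Good N ABC τ a b) (i : Fin N) : |ar (τ i)| = a * b := by
  have := h.ar_sq i
  rw [sq_eq_sq_iff_abs_eq_abs, abs_of_pos (mul_pos h.apos h.bpos)] at this
  exact this

lemma Good.ar_ne (h : Good N ABC τ a b) (i : Fin N) : ar (τ i) ≠ 0 := by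
  have := h.ar_abs i
  intro h0
  rw [h0, abs_zero] at this
  exact (mul_pos h.apos h.bpos).ne this

lemma interior_of_ef (T : Tri) (h : ar T ≠ 0) (z : Pt) (hz : z ∈ triSet T) (hk : ∀ k, ef T k z ≠ 0) :
    z ∈ interior (triSet T) := by
  rw [mem_interior]
  refine ⟨{y | ∀ k, 0 < ar T * ef T k y}, ?_, ?_, ?_⟩
  · intro y hy
    rw [mem_triSet T h]
    exact fun k => (hy k).le
  · have : {y | ∀ k, 0 < ar T * ef T k y} = ⋂ k, {y | 0 < ar T * ef T k y} := by ext; simp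
    rw [this]
    apply isOpen_iInter_of_finite
    intro k
    apply isOpen_lt continuous_const
    unfold ef cr
    fun_prop
  · intro k
    have := (mem_triSet T h z).mp hz k
    exact lt_of_le_of_ne this (mul_ne_zero h (hk k)).symm

open Classical in
lemma Good.AL (h : Good N ABC τ a b)
    (g : Pt → Pt → ℝ) (hg : ∀ P Q R, cr (Q - P) (R - P) = 0 → g P Q + g Q R = g P R) :
    ∑ i, (SignType.sign (ar (τ i)) : ℝ) * ∑ k, g (τ i k) (τ i (k+1)) =
      ∑ k, g (ABC k) (ABC (k+1)) := by
  have key := _root_.AL (J := Option (Fin N)) (fun j => j.elim ABC τ) (fun j => j.elim (-1) (fun _ => 1))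
    (by
      intro j; cases j with
      | none => exact h.arpos.ne'
      | some i => exact h.ar_ne i) ?_ g hg
  · rw [Fintype.sum_option] at key
    simp only [Option.elim, sign_pos h.arpos] at key
    simp only [SignType.coe_one, one_mul] at key
    linarith
  · intro z hz
    rw [Fintype.sum_option]
    show -1 * (if z ∈ triSet ABC then (1:ℝ) else 0) +
      ∑ i, 1 * (if z ∈ triSet (τ i) then (1:ℝ) else 0) = 0
    have hu : ∀ i j, z ∈ triSet (τ i) → z ∈ triSet (τ j) → i = j := by
      intro i j hi hj
      by_contra hne
      have := h.disj i j hne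
      have h1 := interior_of_ef (τ i) (h.ar_ne i) z hi (fun k => hz (some i) k)
      have h2 := interior_of_ef (τ j) (h.ar_ne j) z hj (fun k => hz (some j) k)
      have h3 : z ∈ interior (triSet (τ i)) ∩ interior (triSet (τ j)) := ⟨h1, h2⟩
      rw [this] at h3
      exact h3
    by_cases hA : z ∈ triSet ABC
    · rw [← h.cover] at hA
      obtain ⟨i, hi⟩ := Set.mem_iUnion.mp hA
      rw [h.cover] at hA
      rw [if_pos hA, Finset.sum_eq_single i]
      · simp [hi]
      · intro j _ hj
        rw [if_neg, mul_zero]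
        intro hj2
        exact hj (hu j i hj2 hi)
      · simp
    · rw [if_neg hA]
      have : ∀ i, z ∉ triSet (τ i) := by
        intro i hi
        apply hA
        rw [← h.cover]
        exact Set.mem_iUnion.mpr ⟨i, hi⟩
      simp [this]

lemma Good.area (h : Good N ABC τ a b) : (N : ℝ) * (a * b) = ar ABC := by
  have := h.AL (fun P Q => cr P Q) (by
    intro P Q R hc; simp [cr] at hc ⊢; linarith)
  have e : ∀ T : Tri, ∑ k, cr (T k) (T (k+1)) = ar T := by
    intro T; simp [Fin.sum_univ_three, ar, cr]; ring
  simp only [e] at this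
  rw [← this]
  have : ∀ i, (SignType.sign (ar (τ i)) : ℝ) * ar (τ i) = a * b := by
    intro i; rw [← h.ar_abs i]; exact sign_mul_self _
  simp [this]

open Classical in
/-- potential on horizontal lines -/
def gl (d o : Pt) (S : Set ℝ) (H : Pt → ℝ) (X Y : Pt) : ℝ :=
  if cr d (X - o) = cr d (Y - o) ∧ cr d (X - o) ∈ S then H Y - H X else 0

lemma gl_add (d o : Pt) (S : Set ℝ) (H : Pt → ℝ) (P Q R : Pt)
    (hc : cr (Q - P) (R - P) = 0) : gl d o S H P Q + gl d o S H Q R = gl d o S H P R := by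
  by_cases hPQ : P = Q
  · subst hPQ; simp [gl]
  by_cases hQR : Q = R
  · subst hQR; simp [gl]
  by_cases hPR : P = R
  · subst hPR; unfold gl
    by_cases h1 : cr d (P - o) = cr d (Q - o)
    · by_cases hS : cr d (P - o) ∈ S
      · rw [if_pos ⟨h1, hS⟩, if_pos ⟨h1.symm, h1 ▸ hS⟩, if_pos ⟨rfl, hS⟩]; ring
      · rw [if_neg (fun x => hS x.2), if_neg (fun x => hS (h1 ▸ x.2)), if_neg (fun x => hS x.2)]; ring
    · rw [if_neg (fun x => h1 x.1), if_neg (fun x => h1 x.1.symm)]; simp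
  obtain ⟨t, ht⟩ := (cr_eq_zero_iff _ _ (sub_ne_zero.mpr (Ne.symm hPQ))).mp hc
  have ht0 : t ≠ 0 := by
    rintro rfl; rw [zero_smul, sub_eq_zero] at ht; exact hPR ht.symm
  have ht1 : t ≠ 1 := by
    rintro rfl; rw [one_smul] at ht; exact hQR (sub_left_injective ht).symm
  have e : cr d (R - o) - cr d (P - o) = t * (cr d (Q - o) - cr d (P - o)) := by
    have : R = P + t • (Q - P) := by rw [← ht]; abel
    rw [this]; simp [cr]; ring
  have i1 : cr d (P - o) = cr d (R - o) ↔ cr d (P - o) = cr d (Q - o) := by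
    constructor
    · intro h; rw [← h, sub_self] at e
      have := (mul_eq_zero.mp e.symm).resolve_left ht0
      linarith
    · intro h; rw [← h, sub_self, mul_zero] at e; linarith
  have i2 : cr d (Q - o) = cr d (R - o) ↔ cr d (P - o) = cr d (Q - o) := by
    constructor
    · intro h; rw [← h] at e
      have : (1 - t) * (cr d (Q - o) - cr d (P - o)) = 0 := by linarith
      have := (mul_eq_zero.mp this).resolve_left (sub_ne_zero.mpr ht1.symm)
      linarith
    · intro h; rw [← h]; exact i1.mpr h
  unfold gl
  by_cases h1 : cr d (P - o) = cr d (Q - o)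
  · have h2 := i1.mpr h1
    have h3 := i2.mpr h1
    by_cases hS : cr d (P - o) ∈ S
    · rw [if_pos ⟨h1, hS⟩, if_pos ⟨h3, h1 ▸ hS⟩, if_pos ⟨h2, hS⟩]; ring
    · rw [if_neg (fun x => hS x.2), if_neg (fun x => hS (h1 ▸ x.2)), if_neg (fun x => hS x.2)]; ring
  · rw [if_neg (fun x => h1 x.1), if_neg (fun x => h1 (i2.mp x.1)), if_neg (fun x => h1 (i1.mp x.1))]
    simp

lemma Good.vert_mem (h : Good N ABC τ a b) (i : Fin N) (j : Fin 3) : τ i j ∈ triSet ABC := by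
  rw [← h.cover]
  refine Set.mem_iUnion.mpr ⟨i, ?_⟩
  exact subset_convexHull ℝ _ (Set.mem_range_self j)

lemma Good.ef_nonneg (h : Good N ABC τ a b) (i : Fin N) (j k : Fin 3) : 0 ≤ ef ABC k (τ i j) := by
  have := (mem_triSet ABC h.arpos.ne' _).mp (h.vert_mem i j) k
  exact nonneg_of_mul_nonneg_right this h.arpos

lemma ef_third (T : Tri) (k : Fin 3) : ef T k (T (k+2)) = ar T := ar_cyc T k
lemma ef_self (T : Tri) (k : Fin 3) : ef T k (T k) = 0 := by simp [ef, cr]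
lemma ef_self1 (T : Tri) (k : Fin 3) : ef T k (T (k+1)) = 0 := by simp [ef, cr]; ring

/-- edge j of tile i lies on side k of ABC -/
def onS (ABC : Tri) (τ : Fin N → Tri) (k : Fin 3) (i : Fin N) (j : Fin 3) : Prop :=
  ef ABC k (τ i j) = 0 ∧ ef ABC k (τ i (j+1)) = 0

lemma Good.onS_spec (h : Good N ABC τ a b) (k : Fin 3) (i : Fin N) (j : Fin 3)
    (ho : onS ABC τ k i j) : 0 < ef ABC k (τ i (j+2)) ∧
    ∃ l : ℝ, τ i (j+1) - τ i j = l • (ABC (k+1) - ABC k) ∧ 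
      ar (τ i) = l * ef ABC k (τ i (j+2)) := by
  have hd := edge_ne ABC h.arpos.ne' k
  obtain ⟨h1, h2⟩ := ho
  have hc : cr (ABC (k+1) - ABC k) (τ i (j+1) - τ i j) = 0 := by
    unfold ef at h1 h2; simp [cr] at h1 h2 ⊢; linarith
  obtain ⟨l, hl⟩ := (cr_eq_zero_iff _ _ hd).mp hc
  have e : ar (τ i) = l * ef ABC k (τ i (j+2)) := by
    rw [← ar_cyc (τ i) j, hl, cr_smul_left]
    congr 1
    unfold ef at h1 ⊢; simp [cr] at h1 ⊢; linarith
  refine ⟨lt_of_le_of_ne (h.ef_nonneg i _ k) ?_, l, hl, e⟩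
  intro h0
  rw [← h0, mul_zero] at e
  exact h.ar_ne i e

open Classical in
lemma Good.side_sum (h : Good N ABC τ a b) (k : Fin 3) (H : Pt → ℝ) :
    ∑ i, ∑ j, (if onS ABC τ k i j then (SignType.sign (ar (τ i)) : ℝ) * (H (τ i (j+1)) - H (τ i j)) else 0)
     = H (ABC (k+1)) - H (ABC k) := by
  have := h.AL (gl (ABC (k+1) - ABC k) (ABC k) {0} H) (gl_add _ _ _ _)
  have e0 : ∀ f : Fin 3 → ℝ, ∑ j, f j = f k + f (k+1) + f (k+2) := by
    intro f; fin_cases k <;> simp [Fin.sum_univ_three] <;> ring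
  have ge : ∀ X Y, gl (ABC (k+1) - ABC k) (ABC k) {0} H X Y =
      if ef ABC k X = 0 ∧ ef ABC k Y = 0 then H Y - H X else 0 := by
    intro X Y
    unfold gl ef
    congr 1
    simp only [Set.mem_singleton_iff, eq_iff_iff]
    constructor
    · rintro ⟨x, y⟩; exact ⟨y, by rw [← x, y]⟩
    · rintro ⟨x, y⟩; exact ⟨by rw [x, y], x⟩
  rw [e0 (fun j => gl (ABC (k+1) - ABC k) (ABC k) {0} H (ABC j) (ABC (j+1)))] at this
  have k3 : k + 2 + 1 = k := by fin_cases k <;> rfl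
  have k2 : k + 1 + 1 = k + 2 := by fin_cases k <;> rfl
  simp only [ge, k3, k2, ef_third, ef_self, ef_self1, h.arpos.ne'] at this
  simp only [and_false, false_and, if_false, and_true, if_true, add_zero] at this
  rw [← this]
  apply Finset.sum_congr rfl
  intro i _
  rw [Finset.mul_sum]
  apply Finset.sum_congr rfl
  intro j _
  by_cases ho : ef ABC k (τ i j) = 0 ∧ ef ABC k (τ i (j+1)) = 0
  · rw [if_pos ho, if_pos (show onS ABC τ k i j from ho)]
  · rw [if_neg ho, if_neg (show ¬ onS ABC τ k i j from ho), mul_zero]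

open Classical in
/-- number of edges of type j on side k -/
def cnt (ABC : Tri) (τ : Fin N → Tri) (k j : Fin 3) : ℕ := (Finset.univ.filter (fun i => onS ABC τ k i j)).card

lemma nsq_smul (t : ℝ) (v : Pt) : nsq (t • v) = t ^ 2 * nsq v := by simp [nsq]; ring

lemma Good.side_len (h : Good N ABC τ a b) (k : Fin 3) (L : ℝ) (hL : 0 < L)
    (hL2 : nsq (ABC (k+1) - ABC k) = L ^ 2) :
    L = cnt ABC τ k 1 * a + cnt ABC τ k 2 * b + cnt ABC τ k 0 := by
  classical
  have hd := edge_ne ABC h.arpos.ne' k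
  have hn := normSq_pos _ hd
  have := h.side_sum k (fun z => L * lc (ABC k) (ABC (k+1) - ABC k) z)
  have e1 : L * lc (ABC k) (ABC (k+1) - ABC k) (ABC (k+1)) - L * lc (ABC k) (ABC (k+1) - ABC k) (ABC k) = L := by
    have : lc (ABC k) (ABC (k+1) - ABC k) (ABC k) = 0 := by simp [lc]
    have : lc (ABC k) (ABC (k+1) - ABC k) (ABC (k+1)) = 1 := by
      simp only [lc, PiLp.sub_apply] at hn ⊢; field_simp
    simp [*]
  rw [e1] at this
  have e2 : ∀ i j, (if onS ABC τ k i j then (SignType.sign (ar (τ i)) : ℝ) * 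
      (L * lc (ABC k) (ABC (k+1) - ABC k) (τ i (j+1)) - L * lc (ABC k) (ABC (k+1) - ABC k) (τ i j)) else 0)
      = ls a b j * (if onS ABC τ k i j then 1 else 0) := by
    intro i j
    by_cases ho : onS ABC τ k i j
    · rw [if_pos ho, if_pos ho, mul_one]
      obtain ⟨h1, l, h2, h3⟩ := h.onS_spec k i j ho
      have e3 : lc (ABC k) (ABC (k+1) - ABC k) (τ i (j+1)) - lc (ABC k) (ABC (k+1) - ABC k) (τ i j) = l := by
        have : τ i (j+1) = τ i j + l • (ABC (k+1) - ABC k) := by rw [← h2]; abel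
        rw [this]
        unfold lc
        rw [← sub_div, div_eq_iff hn.ne']
        simp; ring
      rw [← mul_sub, e3, h3, sign_mul, sign_pos h1, mul_one]
      have h4 : (SignType.sign l : ℝ) * l = |l| := sign_mul_self _
      have h5 := h.len i j
      rw [h2, nsq_smul, hL2, ← mul_pow, sq_eq_sq_iff_abs_eq_abs, abs_mul, abs_of_pos hL] at h5
      have h6 : 0 < ls a b j := by
        fin_cases j <;> simp [ls, h.apos, h.bpos]
      rw [abs_of_pos h6] at h5
      rw [← h5, ← h4]; ring
    · simp [ho]
  simp only [e2] at this
  rw [← this, Finset.sum_comm, Fin.sum_univ_three]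
  simp only [← Finset.mul_sum, Finset.sum_boole]
  simp only [cnt, ls]
  simp
  ring

lemma Good.side_corner0 (h : Good N ABC τ a b) (k : Fin 3) :
    ∃ i j, onS ABC τ k i j ∧ (τ i j = ABC k ∨ τ i (j+1) = ABC k) := by
  classical
  by_contra hcon
  push Not at hcon
  have hd := edge_ne ABC h.arpos.ne' k
  have := h.side_sum k (fun z => if z = ABC k then 1 else 0)
  rw [if_neg (fun h0 => hd (sub_eq_zero.mpr h0)), if_pos rfl, Finset.sum_eq_zero] at this
  · norm_num at this
  · intro i _
    apply Finset.sum_eq_zero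
    intro j _
    split_ifs with h1 h2 h3 h4
    all_goals first | simp; done | exact absurd ‹_› (hcon i j h1).1 | exact absurd ‹_› (hcon i j h1).2

lemma Good.side_corner1 (h : Good N ABC τ a b) (k : Fin 3) :
    ∃ i j, onS ABC τ k i j ∧ (τ i j = ABC (k+1) ∨ τ i (j+1) = ABC (k+1)) := by
  classical
  by_contra hcon
  push Not at hcon
  have hd := edge_ne ABC h.arpos.ne' k
  have := h.side_sum k (fun z => if z = ABC (k+1) then 1 else 0)
  rw [if_pos rfl, if_neg (fun h0 => hd (sub_eq_zero.mpr h0.symm)), Finset.sum_eq_zero] at this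
  · norm_num at this
  · intro i _
    apply Finset.sum_eq_zero
    intro j _
    split_ifs with h1 h2 h3 h4
    all_goals first | simp; done | exact absurd ‹_› (hcon i j h1).1 | exact absurd ‹_› (hcon i j h1).2

end

section
open EuclideanGeometry Real
open scoped Topology
variable {N : ℕ} {ABC : Tri} {τ : Fin N → Tri} {a b : ℝ}

lemma gdir_add (φ : Pt → ℝ) (hφ : ∀ (t : ℝ) (v : Pt), t ≠ 0 → φ (t • v) = φ v) (f : Pt → ℝ)
    (P Q R : Pt) (hc : cr (Q - P) (R - P) = 0) :
    φ (Q - P) * (f Q - f P) + φ (R - Q) * (f R - f Q) = φ (R - P) * (f R - f P) := by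
  by_cases hPQ : P = Q
  · subst hPQ; simp
  by_cases hQR : Q = R
  · subst hQR; simp
  by_cases hPR : P = R
  · subst hPR
    have := hφ (-1) (Q - P) (by norm_num)
    rw [neg_one_smul, neg_sub] at this
    rw [this]; simp; ring
  obtain ⟨t, ht⟩ := (cr_eq_zero_iff _ _ (sub_ne_zero.mpr (Ne.symm hPQ))).mp hc
  have ht0 : t ≠ 0 := by
    rintro rfl; rw [zero_smul, sub_eq_zero] at ht; exact hPR ht.symm
  have ht1 : t - 1 ≠ 0 := by
    intro h0
    have : t = 1 := by linarith
    rw [this, one_smul] at ht; exact hQR (sub_left_injective ht).symm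
  have h2 : R - Q = (t - 1) • (Q - P) := by rw [sub_smul, ← ht, one_smul]; abel
  rw [h2, ht, hφ t _ ht0, hφ _ _ ht1]; ring

lemma Good.ls_mem (h : Good N ABC τ a b) (K : Subfield ℝ) (ha : a ∈ K) (hb : b ∈ K) (j : Fin 3) :
    ls a b j ∈ K := by
  fin_cases j
  · exact K.one_mem
  · exact ha
  · exact hb

lemma Good.ls_pos (h : Good N ABC τ a b) (j : Fin 3) : 0 < ls a b j := by
  fin_cases j <;> simp [ls, h.apos, h.bpos]

lemma Good.ar_mem (h : Good N ABC τ a b) (K : Subfield ℝ) (ha : a ∈ K) (hb : b ∈ K) (i : Fin N) :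
    ar (τ i) ∈ K := by
  have := h.ar_abs i
  rcases abs_choice (ar (τ i)) with h1 | h1
  · rw [← h1, this]; exact K.mul_mem ha hb
  · rw [show ar (τ i) = -(a*b) by linarith]; exact K.neg_mem (K.mul_mem ha hb)

/-- edge vector in K-coordinates -/
def EK (K : Subfield ℝ) (e v : Pt) : Prop := dt e v ∈ K ∧ cr e v ∈ K

lemma Good.EK_next (h : Good N ABC τ a b) (K : Subfield ℝ) (ha : a ∈ K) (hb : b ∈ K) (e : Pt)
    (i : Fin N) (j : Fin 3) (hE : EK K e (τ i (j+1) - τ i j)) :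
    EK K e (τ i (j+1+1) - τ i (j+1)) := by
  set u := τ i (j+1) - τ i j with hu
  set v := τ i (j+1+1) - τ i (j+1) with hv
  have n1 := h.len i j
  have n2 := h.len i (j+1)
  have n3 := h.len i (j+1+1)
  rw [← hu] at n1; rw [← hv] at n2
  have j3 : j + 1 + 1 + 1 = j := by fin_cases j <;> rfl
  have e3 : τ i (j+1+1+1) - τ i (j+1+1) = - (u + v) := by rw [j3, hu, hv]; abel
  rw [e3] at n3
  have hn : nsq u ≠ 0 := by rw [n1]; exact pow_ne_zero _ (h.ls_pos j).ne'
  have hnK : nsq u ∈ K := by rw [n1]; exact K.pow_mem (h.ls_mem K ha hb j) 2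
  have hdt : dt u v = (nsq (-(u+v)) - nsq u - nsq v) / 2 := by simp [nsq, dt]; ring
  have hdK : dt u v ∈ K := by
    rw [hdt, n1, n2, n3]
    refine K.div_mem (K.sub_mem (K.sub_mem ?_ ?_) ?_) (ofNat_mem K 2) <;>
      exact K.pow_mem (h.ls_mem K ha hb _) 2
  have hcK : cr u v ∈ K := by
    have : cr u v = ar (τ i) := by
      rw [← ar_cyc (τ i) j, hv, hu]
      have : j + 1 + 1 = j + 2 := by fin_cases j <;> rfl
      rw [this]; simp [cr]; ring
    rw [this]; exact h.ar_mem K ha hb i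
  constructor
  · have : dt e v = (dt u v * dt e u - cr u v * cr e u) / nsq u := by
      rw [eq_div_iff hn]; simp [nsq, dt, cr]; ring
    rw [this]
    exact K.div_mem (K.sub_mem (K.mul_mem hdK hE.1) (K.mul_mem hcK hE.2)) hnK
  · have : cr e v = (dt u v * cr e u + cr u v * dt e u) / nsq u := by
      rw [eq_div_iff hn]; simp [nsq, dt, cr]; ring
    rw [this]
    exact K.div_mem (K.add_mem (K.mul_mem hdK hE.2) (K.mul_mem hcK hE.1)) hnK

lemma Good.EK_all (h : Good N ABC τ a b) (K : Subfield ℝ) (ha : a ∈ K) (hb : b ∈ K) (e : Pt)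
    (i : Fin N) (j : Fin 3) (hE : EK K e (τ i (j+1) - τ i j)) (l : Fin 3) :
    EK K e (τ i (l+1) - τ i l) := by
  have h1 := h.EK_next K ha hb e i j hE
  have h2 := h.EK_next K ha hb e i _ h1
  fin_cases j <;> fin_cases l <;> first | exact hE | exact h1 | exact h2

open Classical in
/-- slope potential -/
def sl (K : Subfield ℝ) (s : ℝ →+ ℝ) (e v : Pt) : ℝ :=
  if dt e v / √(nsq v) ∈ K ∧ cr e v / √(nsq v) ∈ K then s (dt e v / cr e v) else 0

lemma sl_smul (K : Subfield ℝ) (s : ℝ →+ ℝ) (e : Pt) (t : ℝ) (v : Pt) (ht : t ≠ 0) :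
    sl K s e (t • v) = sl K s e v := by
  have e1 : dt e (t • v) = t * dt e v := by simp [dt]; ring
  have e2 : √(nsq (t • v)) = |t| * √(nsq v) := by
    rw [nsq_smul, Real.sqrt_mul (sq_nonneg t), Real.sqrt_sq_eq_abs]
  have e3 : dt e (t • v) / cr e (t • v) = dt e v / cr e v := by
    rw [e1, cr_smul_right, mul_div_mul_left _ _ ht]
  have hs : ∀ x : ℝ, (t * x / (|t| * √(nsq v)) ∈ K ↔ x / √(nsq v) ∈ K) := by
    intro x
    rcases lt_or_gt_of_ne ht with h1 | h1
    · rw [abs_of_neg h1, show t * x / (-t * √(nsq v)) = - (x / √(nsq v)) by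
        rw [neg_mul, div_neg, mul_div_mul_left _ _ ht], neg_mem_iff]
    · rw [abs_of_pos h1, mul_div_mul_left _ _ ht]
  unfold sl
  rw [e3]
  congr 1
  rw [e1, e2, cr_smul_right, hs, hs]

lemma Good.sl_edge (h : Good N ABC τ a b) (K : Subfield ℝ) (ha : a ∈ K) (hb : b ∈ K) (s : ℝ →+ ℝ)
    (e : Pt) (i : Fin N) (j : Fin 3) :
    (EK K e (τ i (j+1) - τ i j) → sl K s e (τ i (j+1) - τ i j) =
      s (dt e (τ i (j+1) - τ i j) / cr e (τ i (j+1) - τ i j))) ∧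
    (¬ EK K e (τ i (j+1) - τ i j) → sl K s e (τ i (j+1) - τ i j) = 0) := by
  have hl := h.ls_mem K ha hb j
  have hp := h.ls_pos j
  have e1 : √(nsq (τ i (j+1) - τ i j)) = ls a b j := by
    rw [h.len, Real.sqrt_sq hp.le]
  have hiff : ∀ x, x / ls a b j ∈ K ↔ x ∈ K := by
    intro x
    constructor
    · intro hx
      have := K.mul_mem hx hl
      rwa [div_mul_cancel₀ _ hp.ne'] at this
    · intro hx; exact K.div_mem hx hl
  unfold sl EK
  rw [e1, hiff, hiff]
  constructor
  · intro hh; rw [if_pos hh]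
  · intro hh; rw [if_neg hh]

lemma s_ne (K : Subfield ℝ) (s : ℝ →+ ℝ) (s1 : s 1 = 1) (sm : ∀ k ∈ K, ∀ t, s (k * t) = s k * s t)
    (k : ℝ) (hk : k ∈ K) (h0 : k ≠ 0) : s k ≠ 0 := by
  intro h
  have := sm k hk k⁻¹
  rw [mul_inv_cancel₀ h0, s1, h, zero_mul] at this
  exact one_ne_zero this

lemma s_div (K : Subfield ℝ) (s : ℝ →+ ℝ) (s1 : s 1 = 1) (sm : ∀ k ∈ K, ∀ t, s (k * t) = s k * s t)
    (k l : ℝ) (hl : l ∈ K) (h0 : l ≠ 0) : s (k / l) = s k / s l := by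
  have := sm l hl (k / l)
  rw [mul_div_cancel₀ _ h0] at this
  rw [this, mul_div_cancel_left₀ _ (s_ne K s s1 sm l hl h0)]

lemma Good.sgn_s (h : Good N ABC τ a b) (s : ℝ →+ ℝ) (i : Fin N) :
    (SignType.sign (ar (τ i)) : ℝ) * s (ar (τ i)) = s (a * b) := by
  have := h.ar_abs i
  rcases lt_or_gt_of_ne (h.ar_ne i) with h1 | h1
  · rw [abs_of_neg h1] at this
    rw [sign_neg h1, ← this, map_neg]; simp
  · rw [abs_of_pos h1] at this
    rw [sign_pos h1, ← this]; simp

lemma Good.signCore (h : Good N ABC τ a b) (K : Subfield ℝ) (s : ℝ →+ ℝ) (s1 : s 1 = 1)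
    (sm : ∀ k ∈ K, ∀ t, s (k * t) = s k * s t) (ha : a ∈ K) (hb : b ∈ K) (e o : Pt)
    (hen : nsq e = 1) (ε : ℝ) (hε : ε ≠ 0) (hA : ∀ m, 0 ≤ ε * s (cr e (ABC m - o)))
    (i0 : Fin N) (hK0 : ∀ j, EK K e (τ i0 (j+1) - τ i0 j)) (j0 : Fin 3) :
    0 ≤ ε * s (cr e (τ i0 j0 - o)) := by
  classical
  by_contra hneg
  push Not at hneg
  have hXY : ∀ u v, cr u v = dt e u * cr e v - cr e u * dt e v := by
    intro u v
    have : cr u v = nsq e * cr u v := by rw [hen, one_mul]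
    rw [this]; simp [nsq, cr, dt]; ring
  have hNn : ∀ v, nsq v = dt e v ^ 2 + cr e v ^ 2 := by
    intro v
    have : nsq v = nsq e * nsq v := by rw [hen, one_mul]
    rw [this]; simp [nsq, cr, dt]; ring
  have sne := s_ne K s s1 sm
  have sdiv := s_div K s s1 sm
  have hab : a * b ∈ K := K.mul_mem ha hb
  have hab0 : a * b ≠ 0 := (mul_pos h.apos h.bpos).ne'
  have sab := sne _ hab hab0
  let KT : Fin N → Prop := fun i => ∀ j, EK K e (τ i (j+1) - τ i j)
  set η : Pt → ℝ := fun v => ε * s (cr e (v - o)) with hη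
  have ηsub : ∀ u v, η u - η v = ε * s (cr e (u - v)) := by
    intro u v
    have : cr e (u - v) = cr e (u - o) - cr e (v - o) := by simp [cr]; ring
    simp only [hη, this, map_sub]; ring
  obtain ⟨⟨im, jm⟩, hm1, hm2⟩ := Finset.exists_min_image
    (Finset.univ.filter (fun p : Fin N × Fin 3 => KT p.1)) (fun p => η (τ p.1 p.2))
    ⟨(i0, j0), by simpa using hK0⟩
  simp only [Finset.mem_filter, Finset.mem_univ, true_and] at hm1 hm2
  set μ := η (τ im jm) with hμ
  have hmin : ∀ i j, KT i → μ ≤ η (τ i j) := fun i j hi => hm2 (i, j) hi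
  have hμ0 : μ < 0 := lt_of_le_of_lt (hmin i0 j0 hK0) hneg
  have hAE : ∀ m, η (ABC m) ≠ μ := fun m h0 => absurd (hA m) (by
    have : η (ABC m) < 0 := h0 ▸ hμ0
    exact not_le.mpr this)
  have k3 : ∀ j : Fin 3, j + 2 + 1 = j := by intro j; fin_cases j <;> rfl
  have k2 : ∀ j : Fin 3, j + 1 + 1 = j + 2 := by intro j; fin_cases j <;> rfl
  -- step 1
  have st1 : ∀ i j, ¬ (cr e (τ i j - o) = cr e (τ i (j+1) - o) ∧ η (τ i j) = μ) := by
    let g := gl e o {y | ε * s y = μ} (fun v => s (dt e (v - o)))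
    have al := h.AL g (gl_add _ _ _ _)
    have gA : ∀ m, g (ABC m) (ABC (m+1)) = 0 := by
      intro m
      simp only [g, gl]
      rw [if_neg (fun hh => hAE m hh.2)]
    simp only [gA, Finset.sum_const_zero] at al
    have key : ∀ i j, (cr e (τ i j - o) = cr e (τ i (j+1) - o) ∧ η (τ i j) = μ) →
        0 < (ε * s (a * b)) * ((SignType.sign (ar (τ i)) : ℝ) * g (τ i j) (τ i (j+1))) := by
      rintro i j ⟨c1, c2⟩
      have gE : g (τ i j) (τ i (j+1)) = s (dt e (τ i (j+1) - τ i j)) := by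
        simp only [g, gl]
        rw [if_pos ⟨c1, c2⟩, ← map_sub]
        congr 1; simp [dt]; ring
      have cz : cr e (τ i (j+1) - τ i j) = 0 := by
        have : cr e (τ i (j+1) - τ i j) = cr e (τ i (j+1) - o) - cr e (τ i j - o) := by
          simp [cr]; ring
        rw [this, c1, sub_self]
      have hdK : dt e (τ i (j+1) - τ i j) ∈ K := by
        have h1 := hNn (τ i (j+1) - τ i j)
        rw [h.len, cz] at h1
        have h2 : dt e (τ i (j+1) - τ i j) ^ 2 = (ls a b j) ^ 2 := by linarith
        rcases sq_eq_sq_iff_eq_or_eq_neg.mp h2 with h3 | h3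
        · rw [h3]; exact h.ls_mem K ha hb j
        · rw [h3]; exact K.neg_mem (h.ls_mem K ha hb j)
      have hKT : KT i := h.EK_all K ha hb e i j ⟨hdK, by rw [cz]; exact K.zero_mem⟩
      set hh := cr e (τ i (j+2) - τ i j) with hhd
      have hhK : hh ∈ K := by
        have h1 := (hKT (j+2)).2
        rw [k3] at h1
        have : hh = - cr e (τ i j - τ i (j+2)) := by rw [hhd]; simp [cr]; ring
        rw [this]; exact K.neg_mem h1
      have har : ar (τ i) = dt e (τ i (j+1) - τ i j) * hh := by
        rw [← ar_cyc (τ i) j, hXY, cz]; ring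
      have hh0 : hh ≠ 0 := by rintro h0; apply h.ar_ne i; rw [har, h0, mul_zero]
      have p1 := h.sgn_s s i
      rw [gE]
      set D := dt e (τ i (j+1) - τ i j)
      have p2 : s (ar (τ i)) = s D * s hh := by rw [har, sm _ hdK]
      set t := (SignType.sign (ar (τ i)) : ℝ) * s D with ht
      have p3 : t * s hh = s (a * b) := by rw [← p1, p2, ht]; ring
      have t0 : t ≠ 0 := by rintro h0; rw [h0, zero_mul] at p3; exact sab p3.symm
      have p4 : 0 < ε * s hh := by
        refine lt_of_le_of_ne ?_ (mul_ne_zero hε (sne _ hhK hh0)).symm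
        rw [hhd, ← ηsub, c2]
        linarith [hmin i (j+2) hKT]
      rw [← p3]
      have : ε * (t * s hh) * t = (ε * s hh) * t ^ 2 := by ring
      rw [this]
      positivity
    have nn : ∀ i j, 0 ≤ (ε * s (a * b)) * ((SignType.sign (ar (τ i)) : ℝ) * g (τ i j) (τ i (j+1))) := by
      intro i j
      by_cases hc : cr e (τ i j - o) = cr e (τ i (j+1) - o) ∧ η (τ i j) = μ
      · exact (key i j hc).le
      · have : g (τ i j) (τ i (j+1)) = 0 := by
          exact if_neg hc
        rw [this]; simp
    intro i j hc
    have hz : ∑ i, ∑ j, (ε * s (a * b)) * ((SignType.sign (ar (τ i)) : ℝ) * g (τ i j) (τ i (j+1))) = 0 := by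
      simp only [← Finset.mul_sum]; rw [al, mul_zero]
    rw [Finset.sum_eq_zero_iff_of_nonneg (fun i _ => Finset.sum_nonneg (fun j _ => nn i j))] at hz
    have hz1 := hz i (Finset.mem_univ _)
    rw [Finset.sum_eq_zero_iff_of_nonneg (fun j _ => nn i j)] at hz1
    exact (key i j hc).ne' (hz1 j (Finset.mem_univ _))
  -- step 2
  let f : Pt → ℝ := fun v => if η v = μ then 1 else 0
  have al := h.AL (fun P Q => sl K s e (Q - P) * (f Q - f P)) (gdir_add _ (sl_smul K s e) f)
  have fA : ∀ m, f (ABC m) = 0 := fun m => if_neg (hAE m)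
  simp only [fA, sub_self, mul_zero, Finset.sum_const_zero] at al
  have key : ∀ i j, KT i → η (τ i j) = μ →
      0 < (- s (a * b)) * ((SignType.sign (ar (τ i)) : ℝ) *
        ∑ j, sl K s e (τ i (j+1) - τ i j) * (f (τ i (j+1)) - f (τ i j))) := by
    intro i j hi hj
    have e0 : ∀ f : Fin 3 → ℝ, ∑ l, f l = f j + f (j+1) + f (j+2) := by
      intro f; fin_cases j <;> simp [Fin.sum_univ_three] <;> ring
    have d1K : cr e (τ i (j+1) - τ i j) ∈ K := (hi j).2
    have d1 : cr e (τ i (j+1) - τ i j) ≠ 0 := by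
      intro h0
      apply st1 i j
      refine ⟨?_, hj⟩
      have : cr e (τ i (j+1) - τ i j) = cr e (τ i (j+1) - o) - cr e (τ i j - o) := by
        simp [cr]; ring
      linarith
    have d2K : cr e (τ i j - τ i (j+2)) ∈ K := by
      have := (hi (j+2)).2; rwa [k3] at this
    have d2 : cr e (τ i j - τ i (j+2)) ≠ 0 := by
      intro h0
      have : cr e (τ i j - τ i (j+2)) = cr e (τ i j - o) - cr e (τ i (j+2) - o) := by
        simp [cr]; ring
      apply st1 i (j+2)
      rw [k3]
      refine ⟨by linarith, ?_⟩
      have := ηsub (τ i j) (τ i (j+2))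
      rw [h0, map_zero, mul_zero] at this
      linarith
    have x1K : dt e (τ i (j+1) - τ i j) ∈ K := (hi j).1
    have x2K : dt e (τ i j - τ i (j+2)) ∈ K := by
      have := (hi (j+2)).1; rwa [k3] at this
    have f0 : f (τ i j) = 1 := if_pos hj
    have q1 := ηsub (τ i (j+1)) (τ i j)
    have q2 := ηsub (τ i j) (τ i (j+2))
    have f1 : f (τ i (j+1)) = 0 := if_neg (fun h0 => by
      rw [h0, hj, sub_self] at q1
      exact mul_ne_zero hε (sne _ d1K d1) q1.symm)
    have f2 : f (τ i (j+2)) = 0 := if_neg (fun h0 => by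
      rw [h0, hj, sub_self] at q2
      exact mul_ne_zero hε (sne _ d2K d2) q2.symm)
    have z1 := (h.sl_edge K ha hb s e i j).1 (hi j)
    have z2 := (h.sl_edge K ha hb s e i (j+2)).1 (hi (j+2))
    rw [k3] at z2
    rw [e0, k2, k3, f0, f1, f2, z1, z2]
    set u1 := τ i (j+1) - τ i j with hu1
    set u2 := τ i j - τ i (j+2) with hu2
    have har : ar (τ i) = cr u2 u1 := by
      rw [← ar_cyc (τ i) j, hu1, hu2]; simp [cr]; ring
    rw [hXY] at har
    have r1 : dt e u2 / cr e u2 - dt e u1 / cr e u1 = ar (τ i) / (cr e u1 * cr e u2) := by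
      rw [har]; field_simp
    have r2 : s (dt e u2 / cr e u2) - s (dt e u1 / cr e u1) = s (ar (τ i)) / (s (cr e u1) * s (cr e u2)) := by
      rw [← map_sub, r1, sdiv _ _ (K.mul_mem d1K d2K) (mul_ne_zero d1 d2), sm _ d1K]
    have p1 := h.sgn_s s i
    have w1 : 0 < ε * s (cr e u1) := by
      refine lt_of_le_of_ne ?_ (mul_ne_zero hε (sne _ d1K d1)).symm
      rw [← q1, hj]; linarith [hmin i (j+1) hi]
    have w2 : ε * s (cr e u2) < 0 := by
      refine lt_of_le_of_ne ?_ (mul_ne_zero hε (sne _ d2K d2))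
      rw [← q2, hj]; linarith [hmin i (j+2) hi]
    have w3 : s (cr e u1) * s (cr e u2) < 0 := by
      have := mul_neg_of_pos_of_neg w1 w2
      have e2 : 0 < ε ^ 2 := by positivity
      by_contra hc
      push Not at hc
      nlinarith [mul_nonneg e2.le hc]
    have : (- s (a * b)) * ((SignType.sign (ar (τ i)) : ℝ) *
      (s (dt e u1 / cr e u1) * (0 - 1) + sl K s e (τ i (j + 2) - τ i (j + 1)) * (0 - 0) +
       s (dt e u2 / cr e u2) * (1 - 0))) = (s (a * b)) ^ 2 / (- (s (cr e u1) * s (cr e u2))) := by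
      have : (- s (a * b)) * ((SignType.sign (ar (τ i)) : ℝ) *
        (s (dt e u1 / cr e u1) * (0 - 1) + sl K s e (τ i (j + 2) - τ i (j + 1)) * (0 - 0) +
       s (dt e u2 / cr e u2) * (1 - 0))) = (- s (a * b)) * ((SignType.sign (ar (τ i)) : ℝ) * 
         (s (dt e u2 / cr e u2) - s (dt e u1 / cr e u1))) := by ring
      rw [this, r2, mul_div_assoc', p1, div_neg]; ring
    rw [this]
    apply div_pos
    · positivity
    · linarith
  have nn : ∀ i, 0 ≤ (- s (a * b)) * ((SignType.sign (ar (τ i)) : ℝ) *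
        ∑ j, sl K s e (τ i (j+1) - τ i j) * (f (τ i (j+1)) - f (τ i j))) := by
    intro i
    by_cases hi : KT i
    · by_cases hj : ∃ j, η (τ i j) = μ
      · obtain ⟨j, hj⟩ := hj
        exact (key i j hi hj).le
      · push Not at hj
        have : ∀ j, f (τ i j) = 0 := fun j => if_neg (hj j)
        simp [this]
    · have : ∀ j, sl K s e (τ i (j+1) - τ i j) = 0 := by
        intro j
        apply (h.sl_edge K ha hb s e i j).2
        intro hE
        exact hi (h.EK_all K ha hb e i j hE)
      simp [this]
  have hz : ∑ i, (- s (a * b)) * ((SignType.sign (ar (τ i)) : ℝ) *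
        ∑ j, sl K s e (τ i (j+1) - τ i j) * (f (τ i (j+1)) - f (τ i j))) = 0 := by
    rw [← Finset.mul_sum, al, mul_zero]
  rw [Finset.sum_eq_zero_iff_of_nonneg (fun i _ => nn i)] at hz
  exact (key im jm hm1 rfl).ne' (hz im (Finset.mem_univ _))

/-- Sign lemma -/
lemma Good.signS (h : Good N ABC τ a b) (K : Subfield ℝ) (s : ℝ →+ ℝ) (s1 : s 1 = 1)
    (sm : ∀ k ∈ K, ∀ t, s (k * t) = s k * s t) (ha : a ∈ K) (hb : b ∈ K) (k : Fin 3)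
    (L : ℝ) (hL : 0 < L) (hLK : L ∈ K) (hL2 : nsq (ABC (k+1) - ABC k) = L ^ 2)
    (i0 : Fin N) (j0 : Fin 3) (ho : onS ABC τ k i0 j0) : 0 < s (ls a b j0) * s L := by
  classical
  set e : Pt := L⁻¹ • (ABC (k+1) - ABC k) with he
  have hce : ∀ v, cr e v = L⁻¹ * cr (ABC (k+1) - ABC k) v := fun v => by rw [he, cr_smul_left]
  have hef : ∀ v, cr e (v - ABC k) = ef ABC k v / L := fun v => by rw [hce, div_eq_inv_mul]; rfl
  have hen : nsq e = 1 := by rw [he, nsq_smul, hL2]; field_simp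
  have sne := s_ne K s s1 sm
  have sdiv := s_div K s s1 sm
  have hab : a * b ∈ K := K.mul_mem ha hb
  have hab0 : a * b ≠ 0 := (mul_pos h.apos h.bpos).ne'
  have sab := sne _ hab hab0
  have sL := sne L hLK hL.ne'
  have lsK := h.ls_mem K ha hb j0
  have sl0 := sne _ lsK (h.ls_pos j0).ne'
  obtain ⟨hb1, l, hb2, hb3⟩ := h.onS_spec k i0 j0 ho
  have hN : (N : ℝ) ≠ 0 := by
    intro h0; have := h.area; rw [h0, zero_mul] at this; exact h.arpos.ne this
  have hsN : ∀ t, s ((N:ℝ) * t) = N * s t := by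
    intro t; rw [← nsmul_eq_mul, map_nsmul, nsmul_eq_mul]
  -- edge vector
  have hl : |l| * L = ls a b j0 := by
    have := h.len i0 j0
    rw [hb2, nsq_smul, hL2, ← mul_pow, sq_eq_sq_iff_abs_eq_abs, abs_mul, abs_of_pos hL,
      abs_of_pos (h.ls_pos j0)] at this
    exact this
  have hlK : l * L ∈ K := by
    rcases abs_choice l with h1 | h1
    · rw [h1] at hl; rw [hl]; exact lsK
    · rw [h1] at hl; rw [show l * L = - ls a b j0 by linarith]; exact K.neg_mem lsK
  have hK0 : ∀ j, EK K e (τ i0 (j+1) - τ i0 j) := by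
    apply h.EK_all K ha hb e i0 j0
    have d1 : dt e (τ i0 (j0+1) - τ i0 j0) = l * L := by
      rw [hb2]
      have : dt e (l • (ABC (k+1) - ABC k)) = l * (L⁻¹ * nsq (ABC (k+1) - ABC k)) := by
        rw [he]; simp [dt, nsq]; ring
      rw [this, hL2]; field_simp
    have d2 : cr e (τ i0 (j0+1) - τ i0 j0) = 0 := by
      rw [hb2, hce, cr_smul_right]
      have : cr (ABC (k+1) - ABC k) (ABC (k+1) - ABC k) = 0 := by unfold cr; ring
      rw [this]; ring
    exact ⟨by rw [d1]; exact hlK, by rw [d2]; exact K.zero_mem⟩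
  have hth : cr e (τ i0 (j0+2) - ABC k) = (a * b) / ls a b j0 := by
    rw [hef, ← h.ar_abs i0, hb3, abs_mul, abs_of_pos hb1, ← hl]
    have : |l| ≠ 0 := by
      intro h0; rw [h0, zero_mul] at hl; exact (h.ls_pos j0).ne hl
    field_simp
  have core := h.signCore K s s1 sm ha hb e (ABC k) hen (s (a * b) / s L) (div_ne_zero sab sL) ?_ i0 hK0 (j0+2)
  · rw [hth, sdiv _ _ lsK (h.ls_pos j0).ne'] at core
    refine lt_of_le_of_ne ?_ (mul_ne_zero sl0 sL).symm
    by_contra hc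
    push Not at hc
    have : s (a * b) / s L * (s (a * b) / s (ls a b j0)) = (s (a*b))^2 / (s (ls a b j0) * s L) := by
      field_simp
    rw [this] at core
    have p : 0 < (s (a*b))^2 := by positivity
    exact absurd core (not_le.mpr (div_neg_of_pos_of_neg p hc))
  · have e1 : 0 ≤ s (a * b) / s L * s (cr e (ABC (k+2) - ABC k)) := by
      rw [hef, ef_third, ← h.area, mul_div_assoc, hsN, sdiv _ _ hLK hL.ne']
      have : s (a * b) / s L * (N * (s (a * b) / s L)) = N * (s (a * b) / s L) ^ 2 := by ring
      rw [this]; positivity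
    have e2 : s (a * b) / s L * s (cr e (ABC k - ABC k)) = 0 := by rw [hef, ef_self]; simp
    have e3 : s (a * b) / s L * s (cr e (ABC (k+1) - ABC k)) = 0 := by rw [hef, ef_self1]; simp
    intro m
    have : m = k ∨ m = k+1 ∨ m = k+2 := by
      fin_cases k <;> fin_cases m <;> simp
    rcases this with rfl | rfl | rfl
    · rw [e2]
    · rw [e3]
    · exact e1

end

section
open EuclideanGeometry Real
open scoped Topology
variable {N : ℕ} {ABC : Tri} {τ : Fin N → Tri} {a b : ℝ}

/-- complex number with argument the angle from u to v -/
def wc (u v : Pt) : ℂ := ⟨dt u v, cr u v⟩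

/-- angle potential -/
def gz (z P Q : Pt) : ℝ :=
  arctan (dt (Q - P) (Q - z) / cr (P - z) (Q - P)) - arctan (dt (Q - P) (P - z) / cr (P - z) (Q - P))

lemma gz_add (z P Q R : Pt) (hc : cr (Q - P) (R - P) = 0) : gz z P Q + gz z Q R = gz z P R := by
  by_cases hPQ : P = Q
  · subst hPQ; simp [gz]
  by_cases hQR : Q = R
  · subst hQR; simp [gz]
  by_cases hPR : P = R
  · subst hPR
    have e1 : dt (P - Q) (P - z) / cr (Q - z) (P - Q) = dt (Q - P) (P - z) / cr (P - z) (Q - P) := by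
      rw [← neg_div_neg_eq]; congr 1 <;> simp [dt, cr] <;> ring
    have e2 : dt (P - Q) (Q - z) / cr (Q - z) (P - Q) = dt (Q - P) (Q - z) / cr (P - z) (Q - P) := by
      rw [← neg_div_neg_eq]; congr 1 <;> simp [dt, cr] <;> ring
    unfold gz
    rw [e1, e2]; ring
  obtain ⟨t, ht⟩ := (cr_eq_zero_iff _ _ (sub_ne_zero.mpr (Ne.symm hPQ))).mp hc
  have ht0 : t ≠ 0 := by
    rintro rfl; rw [zero_smul, sub_eq_zero] at ht; exact hPR ht.symm
  have ht1 : t - 1 ≠ 0 := by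
    intro h0
    have : t = 1 := by linarith
    rw [this, one_smul] at ht; exact hQR (sub_left_injective ht).symm
  have h2 : R - Q = (t - 1) • (Q - P) := by rw [sub_smul, ← ht, one_smul]; abel
  have dts : ∀ (x : ℝ) u v, dt (x • u) v = x * dt u v := by intros; simp [dt]; ring
  have hq : cr (Q - z) (Q - P) = cr (P - z) (Q - P) := by simp [cr]; ring
  unfold gz
  rw [h2, ht]
  simp only [dts, cr_smul_right, mul_div_mul_left _ _ ht0, mul_div_mul_left _ _ ht1, hq]
  ring

lemma gz_zero (z P Q : Pt) (h : cr (P - z) (Q - z) = 0) : gz z P Q = 0 := by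
  have : cr (P - z) (Q - P) = 0 := by rw [← h]; simp [cr]; ring
  simp [gz, this]

lemma gz_arg (z P Q : Pt) (h : cr (P - z) (Q - z) ≠ 0) : gz z P Q = (wc (P - z) (Q - z)).arg := by
  set u := P - z with hu
  set v := Q - z with hv
  have hd : Q - P = v - u := by rw [hu, hv]; abel
  have hc : cr u (v - u) = cr u v := by simp [cr]; ring
  unfold gz
  rw [hd, ← hu, ← hv, hc]
  set hh := cr u v with hhd
  set x := dt (v - u) v / hh with hx
  set y := dt (v - u) u / hh with hy
  have hn : 0 < nsq (v - u) := by
    apply normSq_pos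
    intro h0
    apply h
    rw [hhd, sub_eq_zero.mp h0]; simp [cr]; ring
  have px : 0 < √(1 + x^2) := by positivity
  have py : 0 < √(1 + y^2) := by positivity
  have c1 : cos (arctan x - arctan y) = (1 + x * y) / (√(1 + x^2) * √(1 + y^2)) := by
    rw [cos_sub, cos_arctan, cos_arctan, sin_arctan, sin_arctan]; field_simp
  have c2 : sin (arctan x - arctan y) = (x - y) / (√(1 + x^2) * √(1 + y^2)) := by
    rw [sin_sub, cos_arctan, cos_arctan, sin_arctan, sin_arctan]; field_simp
  set r := hh^2 * (√(1 + x^2) * √(1 + y^2)) / nsq (v - u) with hr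
  have rp : 0 < r := by positivity
  have key : wc u v = (r : ℂ) * (Complex.cos ((arctan x - arctan y : ℝ) : ℂ) + Complex.sin ((arctan x - arctan y : ℝ) : ℂ) * Complex.I) := by
    rw [← Complex.ofReal_cos, ← Complex.ofReal_sin, c1, c2]
    apply Complex.ext
    · simp only [wc, Complex.mul_re, Complex.add_re, Complex.ofReal_re, Complex.I_re, Complex.I_im, Complex.ofReal_im, Complex.add_im, Complex.mul_im]
      rw [hr, hx, hy]
      field_simp
      rw [hhd]; simp [nsq, dt, cr]; ring
    · simp only [wc, Complex.mul_re, Complex.add_re, Complex.ofReal_re, Complex.I_re, Complex.I_im, Complex.ofReal_im, Complex.add_im, Complex.mul_im]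
      rw [hr, hx, hy]
      field_simp
      rw [hhd]; simp [nsq, dt, cr]; ring
  rw [key, Complex.arg_mul_cos_add_sin_mul_I rp]
  constructor
  · linarith [neg_pi_div_two_lt_arctan x, arctan_lt_pi_div_two y]
  · linarith [neg_pi_div_two_lt_arctan y, arctan_lt_pi_div_two x]

lemma wc_prod (u v w : Pt) : wc u v * wc v w * wc w u = ((nsq u * nsq v * nsq w : ℝ) : ℂ) := by
  apply Complex.ext
  · rw [Complex.ofReal_re]; simp only [wc, Complex.mul_re, Complex.mul_im, dt, cr, nsq]; ring
  · rw [Complex.ofReal_im]; simp only [wc, Complex.mul_re, Complex.mul_im, dt, cr, nsq]; ring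

lemma wc_ne (u v : Pt) (hu : u ≠ 0) (hv : v ≠ 0) : wc u v ≠ 0 := by
  intro h
  have h1 : dt u v = 0 := congrArg Complex.re h
  have h2 : cr u v = 0 := congrArg Complex.im h
  have : nsq u * nsq v = dt u v ^ 2 + cr u v ^ 2 := by simp [nsq, dt, cr]; ring
  rw [h1, h2] at this
  have p1 : 0 < nsq u := normSq_pos u hu
  have p2 : 0 < nsq v := normSq_pos v hv
  nlinarith [mul_pos p1 p2]

lemma arg_sum3 (u v w : Pt) (hu : u ≠ 0) (hv : v ≠ 0) (hw : w ≠ 0) :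
    ∃ n : ℤ, (wc u v).arg + (wc v w).arg + (wc w u).arg = 2 * π * n := by
  have h1 := wc_ne u v hu hv
  have h2 := wc_ne v w hv hw
  have h3 := wc_ne w u hw hu
  have h4 := Complex.arg_mul_coe_angle (mul_ne_zero h1 h2) h3
  rw [Complex.arg_mul_coe_angle h1 h2, wc_prod] at h4
  have p1 : 0 < nsq u := normSq_pos u hu
  have p2 : 0 < nsq v := normSq_pos v hv
  have p3 : 0 < nsq w := normSq_pos w hw
  rw [Complex.arg_ofReal_of_nonneg (by positivity)] at h4
  have h5 : (((wc u v).arg + (wc v w).arg + (wc w u).arg : ℝ) : Real.Angle) = ((0:ℝ) : Real.Angle) := by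
    rw [h4]; simp
  obtain ⟨n, hn⟩ := Real.Angle.angle_eq_iff_two_pi_dvd_sub.mp h5
  exact ⟨n, by linarith⟩

lemma real3 (A c0 c1 c2 t0 t1 t2 : ℝ) (n : ℤ) (hA : 0 < A) (hs : c0 + c1 + c2 = A)
    (hn : t0 + t1 + t2 = 2 * π * n)
    (p0 : 0 < c0 → 0 < t0 ∧ t0 < π) (p1 : 0 < c1 → 0 < t1 ∧ t1 < π) (p2 : 0 < c2 → 0 < t2 ∧ t2 < π)
    (n0 : c0 < 0 → -π < t0 ∧ t0 < 0) (n1 : c1 < 0 → -π < t1 ∧ t1 < 0) (n2 : c2 < 0 → -π < t2 ∧ t2 < 0)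
    (z0 : c0 = 0 → t0 = 0 ∨ t0 = π)
    (h1 : c1 ≠ 0) (h2 : c2 ≠ 0) :
    ∃ k : ℕ, k ≤ 2 ∧ (if c0 = 0 then 0 else t0) + t1 + t2 = π * k := by
  have hpi := pi_pos
  have fin : ∀ x : ℝ, ∀ m : ℤ, x = π * m → -π < x → x < 3 * π → ∃ k : ℕ, k ≤ 2 ∧ x = π * k := by
    intro x m hx h1 h2
    have a1 : (-1:ℝ) < m := by
      by_contra hc; push Not at hc; nlinarith
    have a2 : (m:ℝ) < 3 := by
      by_contra hc; push Not at hc; nlinarith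
    have a3 : -1 < m := by exact_mod_cast a1
    have a4 : m < 3 := by exact_mod_cast a2
    obtain ⟨k, rfl⟩ := Int.eq_ofNat_of_zero_le (show 0 ≤ m by omega)
    exact ⟨k, by omega, by rw [hx]; simp⟩
  by_cases hz : c0 = 0
  · rw [if_pos hz]
    have ex : ∃ m : ℤ, 0 + t1 + t2 = π * m := by
      rcases z0 hz with h | h
      · exact ⟨2 * n, by push_cast; linarith⟩
      · exact ⟨2 * n - 1, by push_cast; linarith⟩
    obtain ⟨m, hm⟩ := ex
    have hlt : 0 + t1 + t2 < 2 * π := by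
      rcases lt_or_gt_of_ne h1 with g1 | g1 <;> rcases lt_or_gt_of_ne h2 with g2 | g2
      · linarith [n1 g1, n2 g2]
      · linarith [n1 g1, p2 g2]
      · linarith [p1 g1, n2 g2]
      · linarith [p1 g1, p2 g2]
    have hgt : -π < 0 + t1 + t2 := by
      rcases lt_or_gt_of_ne h1 with g1 | g1 <;> rcases lt_or_gt_of_ne h2 with g2 | g2
      · linarith
      · linarith [n1 g1, p2 g2]
      · linarith [p1 g1, n2 g2]
      · linarith [p1 g1, p2 g2]
    exact fin _ m hm hgt (by linarith)
  · rw [if_neg hz]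
    have hlt : t0 + t1 + t2 < 3 * π := by
      rcases lt_or_gt_of_ne hz with g0 | g0 <;> rcases lt_or_gt_of_ne h1 with g1 | g1 <;> rcases lt_or_gt_of_ne h2 with g2 | g2 <;>
      first
      | linarith [n0 g0, n1 g1, n2 g2]
      | linarith [n0 g0, n1 g1, p2 g2]
      | linarith [n0 g0, p1 g1, n2 g2]
      | linarith [n0 g0, p1 g1, p2 g2]
      | linarith [p0 g0, n1 g1, n2 g2]
      | linarith [p0 g0, n1 g1, p2 g2]
      | linarith [p0 g0, p1 g1, n2 g2]
      | linarith [p0 g0, p1 g1, p2 g2]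
    have hgt : - 2 * π < t0 + t1 + t2 := by
      rcases lt_or_gt_of_ne hz with g0 | g0 <;> rcases lt_or_gt_of_ne h1 with g1 | g1 <;> rcases lt_or_gt_of_ne h2 with g2 | g2 <;>
      first
      | (exfalso; linarith)
      | linarith [n0 g0, n1 g1, p2 g2]
      | linarith [n0 g0, p1 g1, n2 g2]
      | linarith [n0 g0, p1 g1, p2 g2]
      | linarith [p0 g0, n1 g1, n2 g2]
      | linarith [p0 g0, n1 g1, p2 g2]
      | linarith [p0 g0, p1 g1, n2 g2]
      | linarith [p0 g0, p1 g1, p2 g2]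
    have hn0 : 0 ≤ n := by
      have : (-1:ℝ) < n := by
        by_contra hc; push Not at hc; nlinarith
      have : -1 < n := by exact_mod_cast this
      omega
    have hn0' : (0:ℝ) ≤ n := by exact_mod_cast hn0
    exact fin _ (2 * n) (by push_cast; linarith) (by rw [hn]; nlinarith) hlt

end

section
open EuclideanGeometry Real
open scoped Topology
variable {N : ℕ} {ABC : Tri} {τ : Fin N → Tri} {a b : ℝ}

lemma two_zero (z P Q R : Pt) (hR : R ≠ z) (h : cr (Q - P) (R - P) ≠ 0) (h1 : cr (Q - z) (R - z) = 0)
    (h2 : cr (R - z) (P - z) = 0) : False := by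
  have hd : R - z ≠ 0 := sub_ne_zero.mpr hR
  obtain ⟨t, ht⟩ := (cr_eq_zero_iff _ _ hd).mp h2
  have h1' : cr (R - z) (Q - z) = 0 := by
    have : cr (R - z) (Q - z) = - cr (Q - z) (R - z) := by simp [cr]; ring
    rw [this, h1, neg_zero]
  obtain ⟨s, hs⟩ := (cr_eq_zero_iff _ _ hd).mp h1'
  apply h
  have e : cr (Q - P) (R - P) = cr ((Q - z) - (P - z)) ((R - z) - (P - z)) := by
    congr 1 <;> abel
  rw [e, ht, hs]; simp [cr]; ring

lemma wc_pos (u v : Pt) (h : 0 < cr u v) : 0 < (wc u v).arg ∧ (wc u v).arg < π := by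
  have him : 0 < (wc u v).im := h
  constructor
  · rcases (Complex.arg_nonneg_iff.mpr him.le).lt_or_eq with h1 | h1
    · exact h1
    · exfalso
      have := (Complex.arg_eq_zero_iff.mp h1.symm).2
      linarith
  · rcases (Complex.arg_le_pi (wc u v)).lt_or_eq with h1 | h1
    · exact h1
    · exfalso
      have := (Complex.arg_eq_pi_iff.mp h1).2
      linarith

lemma wc_neg (u v : Pt) (h : cr u v < 0) : -π < (wc u v).arg ∧ (wc u v).arg < 0 :=
  ⟨Complex.neg_pi_lt_arg _, Complex.arg_neg_iff.mpr h⟩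

lemma wc_zero (u v : Pt) (h : cr u v = 0) : (wc u v).arg = 0 ∨ (wc u v).arg = π := by
  have him : (wc u v).im = 0 := h
  by_cases hr : 0 ≤ (wc u v).re
  · left; exact Complex.arg_eq_zero_iff.mpr ⟨hr, him⟩
  · right; exact Complex.arg_eq_pi_iff.mpr ⟨by linarith, him⟩

lemma gz_ite (z P Q : Pt) : gz z P Q = if cr (P - z) (Q - z) = 0 then 0 else (wc (P - z) (Q - z)).arg := by
  split_ifs with h
  · exact gz_zero _ _ _ h
  · exact gz_arg _ _ _ h

lemma gz_core (z P Q R : Pt) (h : 0 < cr (Q - P) (R - P)) (hP : P ≠ z) (hQ : Q ≠ z) (hR : R ≠ z)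
    (h1 : cr (Q - z) (R - z) ≠ 0) (h2 : cr (R - z) (P - z) ≠ 0) :
    ∃ k : ℕ, k ≤ 2 ∧ gz z P Q + gz z Q R + gz z R P = π * k := by
  obtain ⟨n, hn⟩ := arg_sum3 (P - z) (Q - z) (R - z) (sub_ne_zero.mpr hP) (sub_ne_zero.mpr hQ) (sub_ne_zero.mpr hR)
  rw [gz_ite z P Q, gz_arg z Q R h1, gz_arg z R P h2]
  apply real3 _ _ _ _ _ _ _ n h ?_ hn (wc_pos _ _) (wc_pos _ _) (wc_pos _ _) (wc_neg _ _) (wc_neg _ _) (wc_neg _ _) (wc_zero _ _) h1 h2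
  simp [cr]; ring

lemma gz_pos (z P Q R : Pt) (h : 0 < cr (Q - P) (R - P)) (hP : P ≠ z) (hQ : Q ≠ z) (hR : R ≠ z) :
    ∃ k : ℕ, k ≤ 2 ∧ gz z P Q + gz z Q R + gz z R P = π * k := by
  have hQR : cr (R - Q) (P - Q) = cr (Q - P) (R - P) := by simp [cr]; ring
  have hRP : cr (P - R) (Q - R) = cr (Q - P) (R - P) := by simp [cr]; ring
  by_cases h1 : cr (Q - z) (R - z) = 0
  · have h2 : cr (R - z) (P - z) ≠ 0 := fun h2 => two_zero z P Q R hR h.ne' h1 h2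
    have h3 : cr (P - z) (Q - z) ≠ 0 := fun h3 => two_zero z R P Q hQ (by rw [hRP]; exact h.ne') h3 h1
    obtain ⟨k, hk, e⟩ := gz_core z Q R P (by rw [hQR]; exact h) hQ hR hP h2 h3
    exact ⟨k, hk, by linarith⟩
  · by_cases h2 : cr (R - z) (P - z) = 0
    · have h3 : cr (P - z) (Q - z) ≠ 0 := fun h3 => two_zero z Q R P hP (by rw [hQR]; exact h.ne') h2 h3
      obtain ⟨k, hk, e⟩ := gz_core z R P Q (by rw [hRP]; exact h) hR hP hQ h3 h1
      exact ⟨k, hk, by linarith⟩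
    · exact gz_core z P Q R h hP hQ hR h1 h2

lemma gz_anti (z P Q : Pt) : gz z Q P = - gz z P Q := by
  have := gz_add z P Q P (by simp [cr])
  have h2 : gz z P P = 0 := by simp [gz]
  linarith

/-- total angle of T at z -/
def gt (z : Pt) (T : Tri) : ℝ := (SignType.sign (ar T) : ℝ) * ∑ k : Fin 3, gz z (T k) (T (k+1))

/-- angle of T at vertex k -/
def va (T : Tri) (k : Fin 3) : ℝ := Complex.arg ⟨dt (T (k+1) - T k) (T (k+2) - T k), |ar T|⟩

lemma gt_nonvert (z : Pt) (T : Tri) (h : ar T ≠ 0) (hz : ∀ k, T k ≠ z) :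
    ∃ k : ℕ, k ≤ 2 ∧ gt z T = π * k := by
  unfold gt
  rw [Fin.sum_univ_three]
  show ∃ k : ℕ, k ≤ 2 ∧ (SignType.sign (ar T) : ℝ) * (gz z (T 0) (T 1) + gz z (T 1) (T 2) + gz z (T 2) (T 0)) = π * k
  rcases lt_or_gt_of_ne h with hn | hp
  · rw [sign_neg hn]
    obtain ⟨k, hk, e⟩ := gz_pos z (T 0) (T 2) (T 1) (by
      have : cr (T 2 - T 0) (T 1 - T 0) = - ar T := by simp [cr, ar]; ring
      rw [this]; linarith) (hz _) (hz _) (hz _)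
    refine ⟨k, hk, ?_⟩
    rw [gz_anti z (T 2) (T 0), gz_anti z (T 1) (T 2), gz_anti z (T 0) (T 1)] at e
    rw [← e]; simp; ring
  · rw [sign_pos hp]
    obtain ⟨k, hk, e⟩ := gz_pos z (T 0) (T 1) (T 2) hp (hz _) (hz _) (hz _)
    exact ⟨k, hk, by rw [← e]; simp⟩

lemma gt_vert (T : Tri) (h : ar T ≠ 0) (m : Fin 3) : gt (T m) T = va T m := by
  have hs : ∑ k : Fin 3, gz (T m) (T k) (T (k+1)) = gz (T m) (T (m+1)) (T (m+2)) := by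
    have z1 : ∀ P Q, gz P P Q = 0 := fun P Q => gz_zero _ _ _ (by simp [cr])
    have z2 : ∀ P Q, gz P Q P = 0 := fun P Q => gz_zero _ _ _ (by simp [cr])
    rw [Fin.sum_univ_three]
    fin_cases m
    · show gz (T 0) (T 0) (T 1) + gz (T 0) (T 1) (T 2) + gz (T 0) (T 2) (T 0) = gz (T 0) (T 1) (T 2)
      rw [z1, z2]; ring
    · show gz (T 1) (T 0) (T 1) + gz (T 1) (T 1) (T 2) + gz (T 1) (T 2) (T 0) = gz (T 1) (T 2) (T 0)
      rw [z1, z2]; ring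
    · show gz (T 2) (T 0) (T 1) + gz (T 2) (T 1) (T 2) + gz (T 2) (T 2) (T 0) = gz (T 2) (T 0) (T 1)
      rw [z1, z2]; ring
  unfold gt va
  have hc := ar_cyc T m
  rw [hs, gz_arg _ _ _ (by rw [hc]; exact h)]
  rcases lt_or_gt_of_ne h with hn | hp
  · rw [sign_neg hn, abs_of_neg hn]
    have e : (⟨dt (T (m+1) - T m) (T (m+2) - T m), -ar T⟩ : ℂ) = (starRingEnd ℂ) (wc (T (m+1) - T m) (T (m+2) - T m)) := by
      apply Complex.ext
      · simp [wc]
      · simp [wc, hc]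
    rw [e, Complex.arg_conj, if_neg]
    · simp
    · have := (wc_neg (T (m+1) - T m) (T (m+2) - T m) (by rw [hc]; exact hn)).2
      intro h2; linarith [pi_pos]
  · rw [sign_pos hp, abs_of_pos hp]
    simp [wc, hc]

/-- angles of the tile -/
def an (a : ℝ) : Fin 3 → ℝ := ![arcsin a, π / 2 - arcsin a, π / 2]

lemma nsq_neg (u v : Pt) : nsq (u - v) = nsq (v - u) := by simp [nsq]; ring
lemma dt_nsq (P Q R : Pt) : dt (Q - P) (R - P) = (nsq (Q - P) + nsq (P - R) - nsq (R - Q)) / 2 := by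
  simp [nsq, dt]; ring

lemma Good.a_lt (h : Good N ABC τ a b) : a < 1 ∧ b < 1 := by
  have := h.sq; have := h.apos; have := h.bpos
  constructor <;> nlinarith

lemma Good.cosa (h : Good N ABC τ a b) : cos (arcsin a) = b := by
  rw [cos_arcsin]
  have : 1 - a^2 = b^2 := by linarith [h.sq]
  rw [this, sqrt_sq h.bpos.le]

lemma Good.sina (h : Good N ABC τ a b) : sin (arcsin a) = a :=
  sin_arcsin (by linarith [h.apos]) h.a_lt.1.le

lemma arg_polar (r t : ℝ) (hr : 0 < r) (ht : t ∈ Set.Ioc (-π) π) : Complex.arg ⟨r * cos t, r * sin t⟩ = t := by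
  refine Eq.trans ?_ (Complex.arg_mul_cos_add_sin_mul_I hr ht)
  congr 1
  rw [← Complex.ofReal_cos, ← Complex.ofReal_sin]
  apply Complex.ext <;> simp [-Complex.ofReal_cos, -Complex.ofReal_sin]

lemma Good.arc (h : Good N ABC τ a b) : 0 < arcsin a ∧ arcsin a < π / 2 :=
  ⟨arcsin_pos.mpr h.apos, arcsin_lt_pi_div_two.mpr h.a_lt.1⟩

lemma Good.va_tile (h : Good N ABC τ a b) (i : Fin N) (j : Fin 3) : va (τ i) j = an a j := by
  have l0 : nsq (τ i 1 - τ i 0) = 1 := by have := h.len i 0; simpa [ls] using this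
  have l1 : nsq (τ i 2 - τ i 1) = a^2 := by have := h.len i 1; simpa [ls] using this
  have l2 : nsq (τ i 0 - τ i 2) = b^2 := by have := h.len i 2; simpa [ls] using this
  have hp := pi_pos
  have hb := h.arc
  unfold va
  rw [h.ar_abs]
  fin_cases j
  · show Complex.arg ⟨dt (τ i 1 - τ i 0) (τ i 2 - τ i 0), _⟩ = arcsin a
    have := arg_polar b (arcsin a) h.bpos ⟨by linarith, by linarith⟩
    rw [h.cosa, h.sina] at this
    refine Eq.trans ?_ this
    congr 2
    · rw [dt_nsq, l0, l1, l2]; linarith [h.sq]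
    · ring
  · show Complex.arg ⟨dt (τ i 2 - τ i 1) (τ i 0 - τ i 1), _⟩ = π / 2 - arcsin a
    have := arg_polar a (π/2 - arcsin a) h.apos ⟨by linarith, by linarith⟩
    rw [cos_pi_div_two_sub, sin_pi_div_two_sub, h.cosa, h.sina] at this
    refine Eq.trans ?_ this
    congr 2
    rw [dt_nsq, l0, l1, l2]; linarith [h.sq]
  · show Complex.arg ⟨dt (τ i 0 - τ i 2) (τ i 1 - τ i 2), _⟩ = π / 2
    have := arg_polar (a*b) (π/2) (mul_pos h.apos h.bpos) ⟨by linarith, by linarith⟩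
    rw [cos_pi_div_two, sin_pi_div_two] at this
    refine Eq.trans ?_ this
    congr 2
    · rw [dt_nsq, l0, l1, l2]; linarith [h.sq]
    · ring

open Classical in
/-- number of tiles with vertex j at z -/
def pc (τ : Fin N → Tri) (j : Fin 3) (z : Pt) : ℕ := (Finset.univ.filter (fun i => τ i j = z)).card

lemma vert_inj (T : Tri) (h : ar T ≠ 0) (j k : Fin 3) (hjk : T j = T k) : j = k := by
  have e := edge_ne T h
  have e0 : T 1 ≠ T 0 := sub_ne_zero.mp (e 0)
  have e1 : T 2 ≠ T 1 := sub_ne_zero.mp (e 1)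
  have e2 : T 0 ≠ T 2 := sub_ne_zero.mp (e 2)
  fin_cases j <;> fin_cases k <;> simp_all

open Classical in
lemma Good.gt_tile (h : Good N ABC τ a b) (z : Pt) (i : Fin N) :
    ∃ k : ℕ, gt z (τ i) = (∑ j : Fin 3, (if τ i j = z then 1 else 0) * an a j) + π * k := by
  by_cases hz : ∃ j, τ i j = z
  · obtain ⟨j, hj⟩ := hz
    refine ⟨0, ?_⟩
    rw [← hj, gt_vert _ (h.ar_ne i), h.va_tile, Finset.sum_eq_single j]
    · simp
    · intro k _ hk
      rw [if_neg (fun e => hk (vert_inj _ (h.ar_ne i) _ _ e)), zero_mul]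
    · simp
  · push Not at hz
    obtain ⟨k, _, e⟩ := gt_nonvert z (τ i) (h.ar_ne i) hz
    refine ⟨k, ?_⟩
    rw [e]; simp [hz]

lemma Good.angle (h : Good N ABC τ a b) (z : Pt) :
    ∃ k : ℕ, (∑ j : Fin 3, (pc τ j z : ℝ) * an a j) + π * k = gt z ABC := by
  classical
  choose k hk using h.gt_tile z
  refine ⟨∑ i, k i, ?_⟩
  have e := h.AL (gz z) (fun P Q R hc => gz_add z P Q R hc)
  have e2 : gt z ABC = ∑ k : Fin 3, gz z (ABC k) (ABC (k+1)) := by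
    unfold gt; rw [sign_pos h.arpos]; simp
  rw [e2, ← e]
  have e3 : ∀ i, (SignType.sign (ar (τ i)) : ℝ) * ∑ k : Fin 3, gz z (τ i k) (τ i (k+1)) = gt z (τ i) := fun i => rfl
  simp only [e3, hk]
  rw [Finset.sum_add_distrib, Finset.sum_comm]
  push_cast
  rw [Finset.mul_sum]
  congr 1
  apply Finset.sum_congr rfl
  intro j _
  rw [← Finset.sum_mul]
  congr 1
  unfold pc
  rw [Finset.card_filter]
  push_cast
  apply Finset.sum_congr rfl
  intro i _
  by_cases hh : τ i j = z <;> simp [hh]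

lemma Good.angle_corner (h : Good N ABC τ a b) (m : Fin 3) :
    (pc τ 0 (ABC m) : ℝ) * arcsin a + pc τ 1 (ABC m) * (π / 2 - arcsin a) + pc τ 2 (ABC m) * (π / 2) = va ABC m
    ∧ 0 < va ABC m ∧ va ABC m < π := by
  obtain ⟨k, hk⟩ := h.angle (ABC m)
  rw [gt_vert _ h.arpos.ne', Fin.sum_univ_three] at hk
  simp only [an, Matrix.cons_val_zero, Matrix.cons_val_one, Matrix.cons_val] at hk
  have hw := wc_pos (ABC (m+1) - ABC m) (ABC (m+2) - ABC m) (by rw [ar_cyc]; exact h.arpos)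
  have e : va ABC m = (wc (ABC (m+1) - ABC m) (ABC (m+2) - ABC m)).arg := by
    unfold va wc; rw [ar_cyc, abs_of_pos h.arpos]
  have hb := h.arc
  have p0 : 0 ≤ (pc τ 0 (ABC m) : ℝ) * arcsin a := mul_nonneg (Nat.cast_nonneg _) hb.1.le
  have p1 : 0 ≤ (pc τ 1 (ABC m) : ℝ) * (π / 2 - arcsin a) := mul_nonneg (Nat.cast_nonneg _) (by linarith)
  have p2 : 0 ≤ (pc τ 2 (ABC m) : ℝ) * (π / 2) := mul_nonneg (Nat.cast_nonneg _) (by linarith [pi_pos])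
  have k0 : k = 0 := by
    by_contra hk0
    have : (1:ℝ) ≤ k := by exact_mod_cast Nat.one_le_iff_ne_zero.mpr hk0
    nlinarith [pi_pos]
  rw [k0] at hk
  refine ⟨?_, e ▸ hw.1, e ▸ hw.2⟩
  rw [← hk]; simp

lemma Good.angle_other (h : Good N ABC τ a b) (z : Pt) (hz : ∀ m, ABC m ≠ z) :
    ∃ k l : ℕ, l ≤ 2 ∧ (pc τ 0 z : ℝ) * arcsin a + pc τ 1 z * (π / 2 - arcsin a) + pc τ 2 z * (π / 2) + π * k = π * l := by
  obtain ⟨k, hk⟩ := h.angle z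
  obtain ⟨l, hl, e⟩ := gt_nonvert z ABC h.arpos.ne' hz
  rw [e, Fin.sum_univ_three] at hk
  exact ⟨k, l, hl, hk⟩

lemma Good.va_sum (h : Good N ABC τ a b) : va ABC 0 + va ABC 1 + va ABC 2 = π := by
  have hp := h.arpos
  have e0 := edge_ne ABC hp.ne' 0
  have e1 := edge_ne ABC hp.ne' 1
  have e2 := edge_ne ABC hp.ne' 2
  obtain ⟨n, hn⟩ := arg_sum3 (ABC 1 - ABC 0) (ABC 2 - ABC 1) (ABC 0 - ABC 2) e0 e1 e2
  have ext : ∀ P Q R : Pt, cr (P - R) (Q - P) = ar ABC →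
      (wc (P - R) (Q - P)).arg = π - Complex.arg ⟨dt (Q - P) (R - P), |ar ABC|⟩ := by
    intro P Q R hc
    have : wc (P - R) (Q - P) = - (starRingEnd ℂ) ⟨dt (Q - P) (R - P), |ar ABC|⟩ := by
      rw [abs_of_pos hp]
      apply Complex.ext
      · simp [wc, dt]; ring
      · simp [wc, hc]
    have hw := wc_pos _ _ (by rw [hc]; exact hp : 0 < cr (P - R) (Q - P))
    have h3 : Complex.arg ⟨dt (Q - P) (R - P), |ar ABC|⟩ ≠ π := by
      intro h4
      have := (Complex.arg_eq_pi_iff.mp h4).2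
      simp at this; exact hp.ne' this
    rw [this, Complex.arg_neg_eq_arg_add_pi_of_im_neg, Complex.arg_conj, if_neg h3]
    · ring
    · simp; exact hp.ne'
  have x1 := ext (ABC 1) (ABC 2) (ABC 0) (by simp [cr, ar]; ring)
  have x2 := ext (ABC 2) (ABC 0) (ABC 1) (by simp [cr, ar]; ring)
  have x0 := ext (ABC 0) (ABC 1) (ABC 2) (by simp [cr, ar]; ring)
  have y0 : va ABC 0 = Complex.arg ⟨dt (ABC 1 - ABC 0) (ABC 2 - ABC 0), |ar ABC|⟩ := rfl
  have y1 : va ABC 1 = Complex.arg ⟨dt (ABC 2 - ABC 1) (ABC 0 - ABC 1), |ar ABC|⟩ := rfl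
  have y2 : va ABC 2 = Complex.arg ⟨dt (ABC 0 - ABC 2) (ABC 1 - ABC 2), |ar ABC|⟩ := rfl
  rw [x1, x2, x0, ← y0, ← y1, ← y2] at hn
  have b0 := (h.angle_corner 0).2
  have b1 := (h.angle_corner 1).2
  have b2 := (h.angle_corner 2).2
  have n1 : (0:ℝ) < n := by by_contra hc; push Not at hc; nlinarith [pi_pos]
  have n2 : (n:ℝ) < 2 := by by_contra hc; push Not at hc; nlinarith [pi_pos]
  have n1' : 0 < n := by exact_mod_cast n1
  have n2' : n < 2 := by exact_mod_cast n2
  have : n = 1 := by omega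
  rw [this] at hn; push_cast at hn; linarith

lemma Good.va_iso (h : Good N ABC τ a b) : va ABC 1 = va ABC 2 := by
  show Complex.arg ⟨dt (ABC 2 - ABC 1) (ABC 0 - ABC 1), |ar ABC|⟩ = Complex.arg ⟨dt (ABC 0 - ABC 2) (ABC 1 - ABC 2), |ar ABC|⟩
  congr 2
  rw [dt_nsq, dt_nsq]
  have := h.iso
  rw [nsq_neg (ABC 2) (ABC 0)] at this
  linarith

lemma Good.sinA (h : Good N ABC τ a b) (X : ℝ) (hX : 0 < X) (h2 : nsq (ABC 1 - ABC 0) = X^2) :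
    N * (a * b) = X^2 * sin (va ABC 0) ∧ nsq (ABC 2 - ABC 1) = 2 * X^2 * (1 - cos (va ABC 0)) := by
  have h3 : nsq (ABC 0 - ABC 2) = X^2 := by rw [nsq_neg, ← h.iso, h2]
  have hn : ‖(⟨dt (ABC 1 - ABC 0) (ABC 2 - ABC 0), |ar ABC|⟩ : ℂ)‖ = X^2 := by
    rw [Complex.norm_eq_sqrt_sq_add_sq]
    have : dt (ABC 1 - ABC 0) (ABC 2 - ABC 0) ^ 2 + |ar ABC|^2 = (X^2)^2 := by
      rw [_root_.sq_abs, _root_.sq (X^2)]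
      nth_rewrite 1 [← h2]
      rw [← h3]
      simp [dt, ar, cr, nsq]; ring
    show √(dt (ABC 1 - ABC 0) (ABC 2 - ABC 0) ^ 2 + |ar ABC|^2) = _
    rw [this, sqrt_sq (by positivity)]
  have hs : sin (va ABC 0) = |ar ABC| / X^2 := by
    show sin (Complex.arg ⟨dt (ABC 1 - ABC 0) (ABC 2 - ABC 0), |ar ABC|⟩) = _
    rw [Complex.sin_arg, hn]
  have hc : cos (va ABC 0) = dt (ABC 1 - ABC 0) (ABC 2 - ABC 0) / X^2 := by
    show cos (Complex.arg ⟨dt (ABC 1 - ABC 0) (ABC 2 - ABC 0), |ar ABC|⟩) = _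
    rw [Complex.cos_arg, hn]
    intro h0
    rw [h0] at hn; simp at hn; exact absurd hn (by positivity)
  constructor
  · rw [hs, h.area, abs_of_pos h.arpos]; field_simp
  · rw [hc, dt_nsq, h2, h3]; field_simp; ring

end

section
open EuclideanGeometry Real
open scoped Topology
variable {N : ℕ} {ABC : Tri} {τ : Fin N → Tri} {a b : ℝ}

lemma combi_ne (x : ℝ) (x0 : 0 < x) (x1 : x < 1) (P Q R : ℕ) (e : P * x + Q * (1 - x) + R = 2) (hPQ : Q < P)
    (p q r k l : ℕ) (hl : l ≤ 2) (e2 : p * x + q * (1 - x) + r + 2 * k = 2 * l) (hqp : p < q) :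
    x = 1/2 ∨ x = 1/3 ∨ x = 2/3 ∨ x = 1/4 ∨ x = 1/5 ∨ x = 2/5 := by
  obtain ⟨n, rfl⟩ := Nat.exists_eq_add_of_lt hPQ
  obtain ⟨m, rfl⟩ := Nat.exists_eq_add_of_lt hqp
  push_cast at e e2
  set j : ℤ := 2 - Q - R with hj
  have ej : ((n:ℝ) + 1) * x = (j:ℝ) := by rw [hj]; push_cast; linarith
  set k' : ℤ := 2 * l - 2 * k - r - p with hk'
  have ek : ((m:ℝ) + 1) * (1 - x) = (k':ℝ) := by rw [hk']; push_cast; linarith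
  have hj0 : 0 < j := by
    have : (0:ℝ) < j := by rw [← ej]; positivity
    exact_mod_cast this
  have hj2 : j ≤ 2 := by omega
  have hk0 : 0 < k' := by
    have : (0:ℝ) < k' := by rw [← ek]; have : 0 < 1 - x := by linarith
                            positivity
    exact_mod_cast this
  have hk4 : k' ≤ 4 := by omega
  have hnj : j < n + 1 := by
    have : (j:ℝ) < n + 1 := by rw [← ej]; nlinarith [(Nat.cast_nonneg n : (0:ℝ) ≤ n)]
    exact_mod_cast this
  have key : ((m:ℤ) + 1) * (n + 1 - j) = k' * (n + 1) := by
    have : ((m:ℝ) + 1) * (n + 1 - j) = k' * (n + 1) := by rw [← ek, ← ej]; ring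
    exact_mod_cast this
  have hd : ((n:ℤ) + 1 - j) ∣ k' * j := ⟨m + 1 - k', by linear_combination -key⟩
  have hle := Int.le_of_dvd (by positivity) hd
  have hn : n ≤ 9 := by nlinarith
  clear_value j k'
  have hx : x = j / (n + 1) := by field_simp; linarith
  clear e e2 ej ek hd hle
  rw [hx]
  interval_cases j <;> interval_cases n <;> first | (exfalso; omega) | norm_num

set_option maxHeartbeats 2000000 in
lemma combi_eq (x : ℝ) (x0 : 0 < x) (x1 : x < 1) (p0 p1 p2 q0 q1 q2 r0 r1 r2 : ℕ)
    (e : (p0 + p1 + p2 : ℕ) * x + (q0 + q1 + q2 : ℕ) * (1 - x) + (r0 + r1 + r2 : ℕ) = 2)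
    (h : p0 + p1 + p2 = q0 + q1 + q2)
    (h0 : 0 < p0 + q0 + r0) (h1 : 0 < p1 + q1 + r1) (h2 : 0 < p2 + q2 + r2)
    (iso : p1 * x + q1 * (1 - x) + r1 = p2 * x + q2 * (1 - x) + r2) :
    x = 1/2 ∨ x = 1/3 ∨ x = 2/3 ∨ (p0 = 2 ∧ q0 = 0 ∧ r0 = 0 ∧ p1 = 0 ∧ q1 = 1 ∧ r1 = 0 ∧ p2 = 0 ∧ q2 = 1 ∧ r2 = 0)
     ∨ (p0 = 0 ∧ q0 = 2 ∧ r0 = 0 ∧ p1 = 1 ∧ q1 = 0 ∧ r1 = 0 ∧ p2 = 1 ∧ q2 = 0 ∧ r2 = 0) := by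
  rw [← h] at e
  have e' : (p0 + p1 + p2) + (r0 + r1 + r2) = 2 := by
    have : (((p0 + p1 + p2) + (r0 + r1 + r2) : ℕ) : ℝ) = 2 := by rw [Nat.cast_add]; linarith
    exact_mod_cast this
  clear e
  rcases (by omega : p0 + p1 + p2 = 0 ∨ p0 + p1 + p2 = 1 ∨ p0 + p1 + p2 = 2) with hP | hP | hP
  · omega
  · have c1 : (p0 = 1 ∧ p1 = 0 ∧ p2 = 0) ∨ (p0 = 0 ∧ p1 = 1 ∧ p2 = 0) ∨ (p0 = 0 ∧ p1 = 0 ∧ p2 = 1) := by omega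
    have c2 : (q0 = 1 ∧ q1 = 0 ∧ q2 = 0) ∨ (q0 = 0 ∧ q1 = 1 ∧ q2 = 0) ∨ (q0 = 0 ∧ q1 = 0 ∧ q2 = 1) := by omega
    have c3 : (r0 = 1 ∧ r1 = 0 ∧ r2 = 0) ∨ (r0 = 0 ∧ r1 = 1 ∧ r2 = 0) ∨ (r0 = 0 ∧ r1 = 0 ∧ r2 = 1) := by omega
    left
    rcases c1 with ⟨rfl, rfl, rfl⟩ | ⟨rfl, rfl, rfl⟩ | ⟨rfl, rfl, rfl⟩ <;>
    rcases c2 with ⟨rfl, rfl, rfl⟩ | ⟨rfl, rfl, rfl⟩ | ⟨rfl, rfl, rfl⟩ <;>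
    rcases c3 with ⟨rfl, rfl, rfl⟩ | ⟨rfl, rfl, rfl⟩ | ⟨rfl, rfl, rfl⟩ <;>
    first
    | (exfalso; omega)
    | (push_cast at iso; linarith)
  · have c1 : (p0 = 2 ∧ p1 = 0 ∧ p2 = 0) ∨ (p0 = 0 ∧ p1 = 2 ∧ p2 = 0) ∨ (p0 = 0 ∧ p1 = 0 ∧ p2 = 2)
      ∨ (p0 = 0 ∧ p1 = 1 ∧ p2 = 1) ∨ (p0 = 1 ∧ p1 = 0 ∧ p2 = 1) ∨ (p0 = 1 ∧ p1 = 1 ∧ p2 = 0) := by omega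
    have c2 : (q0 = 2 ∧ q1 = 0 ∧ q2 = 0) ∨ (q0 = 0 ∧ q1 = 2 ∧ q2 = 0) ∨ (q0 = 0 ∧ q1 = 0 ∧ q2 = 2)
      ∨ (q0 = 0 ∧ q1 = 1 ∧ q2 = 1) ∨ (q0 = 1 ∧ q1 = 0 ∧ q2 = 1) ∨ (q0 = 1 ∧ q1 = 1 ∧ q2 = 0) := by omega
    have c3 : r0 = 0 ∧ r1 = 0 ∧ r2 = 0 := by omega
    obtain ⟨rfl, rfl, rfl⟩ := c3
    rcases c1 with ⟨rfl, rfl, rfl⟩ | ⟨rfl, rfl, rfl⟩ | ⟨rfl, rfl, rfl⟩ | ⟨rfl, rfl, rfl⟩ | ⟨rfl, rfl, rfl⟩ | ⟨rfl, rfl, rfl⟩ <;>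
    rcases c2 with ⟨rfl, rfl, rfl⟩ | ⟨rfl, rfl, rfl⟩ | ⟨rfl, rfl, rfl⟩ | ⟨rfl, rfl, rfl⟩ | ⟨rfl, rfl, rfl⟩ | ⟨rfl, rfl, rfl⟩ <;>
    first
    | (exfalso; omega)
    | (simp; done)
    | (push_cast at iso; left; linarith)
    | (push_cast at iso; right; left; linarith)
    | (push_cast at iso; right; right; left; linarith)

/-- all vertices -/
def VS (ABC : Tri) (τ : Fin N → Tri) : Finset Pt :=
  by classical exact (Finset.univ.image (fun ij : Fin N × Fin 3 => τ ij.1 ij.2)) ∪ Finset.univ.image ABC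

lemma pc_sum (j : Fin 3) : ∑ z ∈ VS ABC τ, pc τ j z = N := by
  classical
  unfold pc
  have := Finset.card_eq_sum_card_fiberwise (s := (Finset.univ : Finset (Fin N))) (t := VS ABC τ) (f := fun i => τ i j) (by
    intro i _
    simp only [VS, Finset.coe_union, Finset.coe_image]
    left; exact ⟨(i, j), by simp, rfl⟩)
  rw [Finset.card_univ, Fintype.card_fin] at this
  rw [eq_comm]; convert this

lemma Good.exists_other (h : Good N ABC τ a b) (j k : Fin 3)
    (hlt : pc τ j (ABC 0) + pc τ j (ABC 1) + pc τ j (ABC 2) < pc τ k (ABC 0) + pc τ k (ABC 1) + pc τ k (ABC 2)) :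
    ∃ z, (∀ m, ABC m ≠ z) ∧ pc τ k z < pc τ j z := by
  classical
  by_contra hc
  push Not at hc
  have hsub : Finset.univ.image ABC ⊆ VS ABC τ := by
    unfold VS; exact Finset.subset_union_right
  have key : ∀ j, ∑ z ∈ VS ABC τ \ Finset.univ.image ABC, pc τ j z + (pc τ j (ABC 0) + pc τ j (ABC 1) + pc τ j (ABC 2)) = N := by
    intro j
    refine Eq.trans ?_ (pc_sum (ABC := ABC) (τ := τ) j)
    rw [← Finset.sum_sdiff hsub]
    congr 1
    rw [Finset.sum_image (fun x _ y _ e => vert_inj ABC h.arpos.ne' x y e), Fin.sum_univ_three]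
  have hle : ∑ z ∈ VS ABC τ \ Finset.univ.image ABC, pc τ j z ≤ ∑ z ∈ VS ABC τ \ Finset.univ.image ABC, pc τ k z := by
    apply Finset.sum_le_sum
    intro z hz
    apply hc
    intro m hm
    apply (Finset.mem_sdiff.mp hz).2
    rw [← hm]; exact Finset.mem_image_of_mem _ (Finset.mem_univ _)
  have k1 := key j
  have k2 := key k
  omega

lemma Good.combi (h : Good N ABC τ a b) : ∃ x : ℝ, arcsin a = π / 2 * x ∧
    (x = 1/2 ∨ x = 1/3 ∨ x = 2/3 ∨ x = 1/4 ∨ x = 3/4 ∨ x = 1/5 ∨ x = 2/5 ∨ x = 3/5 ∨ x = 4/5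
    ∨ (pc τ 0 (ABC 0) = 2 ∧ pc τ 1 (ABC 0) = 0 ∧ pc τ 2 (ABC 0) = 0 ∧ pc τ 0 (ABC 1) = 0 ∧ pc τ 1 (ABC 1) = 1 ∧ pc τ 2 (ABC 1) = 0)
    ∨ (pc τ 0 (ABC 0) = 0 ∧ pc τ 1 (ABC 0) = 2 ∧ pc τ 2 (ABC 0) = 0 ∧ pc τ 0 (ABC 1) = 1 ∧ pc τ 1 (ABC 1) = 0 ∧ pc τ 2 (ABC 1) = 0)) := by
  have hpi := pi_pos
  set x := arcsin a / (π / 2) with hx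
  have hxa : arcsin a = π / 2 * x := by rw [hx]; field_simp
  have harc := h.arc
  have x0 : 0 < x := by rw [hx]; apply div_pos harc.1; linarith
  have x1 : x < 1 := by rw [hx, div_lt_one (by linarith)]; exact harc.2
  refine ⟨x, hxa, ?_⟩
  have c0 := h.angle_corner 0
  have c1 := h.angle_corner 1
  have c2 := h.angle_corner 2
  have hs := h.va_sum
  have hi := h.va_iso
  have hoth := h.angle_other
  have ex1 := h.exists_other 0 1
  have ex2 := h.exists_other 1 0
  rw [hxa] at c0 c1 c2 hoth
  have cne : ∀ p q r : ℕ, ∀ v : ℝ, (p * (π/2*x) + q * (π/2 - π/2*x) + r * (π/2) = v ∧ 0 < v ∧ v < π) → 0 < p + q + r := by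
    rintro p q r v ⟨e, hv, _⟩
    by_contra hc
    have : p = 0 ∧ q = 0 ∧ r = 0 := by omega
    obtain ⟨rfl, rfl, rfl⟩ := this
    simp at e; linarith
  have n0 := cne _ _ _ _ c0
  have n1 := cne _ _ _ _ c1
  have n2 := cne _ _ _ _ c2
  clear cne
  generalize pc τ 0 (ABC 0) = p0 at *
  generalize pc τ 1 (ABC 0) = q0 at *
  generalize pc τ 2 (ABC 0) = r0 at *
  generalize pc τ 0 (ABC 1) = p1 at *
  generalize pc τ 1 (ABC 1) = q1 at *
  generalize pc τ 2 (ABC 1) = r1 at *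
  generalize pc τ 0 (ABC 2) = p2 at *
  generalize pc τ 1 (ABC 2) = q2 at *
  generalize pc τ 2 (ABC 2) = r2 at *
  have canc : ∀ u v : ℝ, π / 2 * u = π / 2 * v → u = v := fun u v e => mul_left_cancel₀ (by positivity) e
  have tot : (p0 + p1 + p2 : ℕ) * x + (q0 + q1 + q2 : ℕ) * (1 - x) + (r0 + r1 + r2 : ℕ) = 2 := by
    apply canc; push_cast; linarith [c0.1, c1.1, c2.1]
  have iso : p1 * x + q1 * (1 - x) + r1 = p2 * x + q2 * (1 - x) + r2 := by
    apply canc; linarith [c0.1, c1.1, c2.1]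
  have oth : ∀ z, (∀ m, ABC m ≠ z) → ∃ k l : ℕ, l ≤ 2 ∧ pc τ 0 z * x + pc τ 1 z * (1 - x) + pc τ 2 z + 2 * k = 2 * (l:ℝ) := by
    intro z hz
    obtain ⟨k, l, hl, e⟩ := hoth z hz
    exact ⟨k, l, hl, by apply canc; linarith⟩
  rcases lt_trichotomy (p0 + p1 + p2) (q0 + q1 + q2) with hlt | heq | hgt
  · obtain ⟨z, hz, hlt2⟩ := ex1 hlt
    obtain ⟨k, l, hl, e⟩ := oth z hz
    have := combi_ne (1 - x) (by linarith) (by linarith) (q0 + q1 + q2) (p0 + p1 + p2) (r0 + r1 + r2) (by linarith) hlt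
      (pc τ 1 z) (pc τ 0 z) (pc τ 2 z) k l hl (by linarith) hlt2
    rcases this with e | e | e | e | e | e
    · left; linarith
    · right; right; left; linarith
    · right; left; linarith
    · right; right; right; right; left; linarith
    · right; right; right; right; right; right; right; right; left; linarith
    · right; right; right; right; right; right; right; left; linarith
  · rcases combi_eq x x0 x1 p0 p1 p2 q0 q1 q2 r0 r1 r2 tot heq n0 n1 n2 iso with e | e | e | e | e
    · left; exact e
    · right; left; exact e
    · right; right; left; exact e
    · right; right; right; right; right; right; right; right; right; left; omega
    · right; right; right; right; right; right; right; right; right; right; omega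
  · obtain ⟨z, hz, hlt2⟩ := ex2 hgt
    obtain ⟨k, l, hl, e⟩ := oth z hz
    have := combi_ne x x0 x1 (p0 + p1 + p2) (q0 + q1 + q2) (r0 + r1 + r2) (by linarith) hgt
      (pc τ 0 z) (pc τ 1 z) (pc τ 2 z) k l hl (by linarith) hlt2
    rcases this with e | e | e | e | e | e
    · left; exact e
    · right; left; exact e
    · right; right; left; exact e
    · right; right; right; left; exact e
    · right; right; right; right; right; left; exact e
    · right; right; right; right; right; right; left; exact e

/-- relabelled tile -/
def sw (T : Tri) : Tri := ![T 1, T 0, T 2]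

lemma sw_triSet (T : Tri) : triSet (sw T) = triSet T := by
  unfold triSet; congr 1
  ext z; simp only [Set.mem_range]
  constructor
  · rintro ⟨j, rfl⟩; fin_cases j
    · exact ⟨1, rfl⟩
    · exact ⟨0, rfl⟩
    · exact ⟨2, rfl⟩
  · rintro ⟨j, rfl⟩; fin_cases j
    · exact ⟨1, rfl⟩
    · exact ⟨0, rfl⟩
    · exact ⟨2, rfl⟩

lemma Good.swap (h : Good N ABC τ a b) : Good N ABC (fun i => sw (τ i)) b a where
  arpos := h.arpos
  apos := h.bpos
  bpos := h.apos
  sq := by linarith [h.sq]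
  len := by
    intro i k
    have l0 : nsq (τ i 1 - τ i 0) = 1 := by have := h.len i 0; simpa [ls] using this
    have l1 : nsq (τ i 2 - τ i 1) = a^2 := by have := h.len i 1; simpa [ls] using this
    have l2 : nsq (τ i 0 - τ i 2) = b^2 := by have := h.len i 2; simpa [ls] using this
    fin_cases k
    · show nsq (τ i 0 - τ i 1) = 1^2; rw [nsq_neg, l0]; norm_num
    · show nsq (τ i 2 - τ i 0) = b^2; rw [nsq_neg, l2]
    · show nsq (τ i 1 - τ i 2) = a^2; rw [nsq_neg, l1]
  disj := by simpa only [sw_triSet] using h.disj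
  cover := by simpa only [sw_triSet] using h.cover
  iso := h.iso

lemma Good.swap_arc (h : Good N ABC τ a b) : arcsin b = π / 2 - arcsin a := by
  rw [← h.cosa, ← sin_pi_div_two_sub, arcsin_sin] <;> linarith [h.arc.1, h.arc.2, pi_pos]

end

section
open EuclideanGeometry Real
open scoped Topology
variable {N : ℕ} {ABC : Tri} {τ : Fin N → Tri} {a b : ℝ}

/-- the conclusion -/
def Concl (N : ℕ) : Prop :=
    (∃ n : ℕ, N = n ^ 2) ∨ (∃ e f : ℕ, N = e ^ 2 + f ^ 2) ∨ (∃ n : ℕ, N = 6 * n ^ 2)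

lemma irr2 (d : ℝ) (h : Irrational d) (u v : ℚ) (e : (u:ℝ) + v * d = 0) : u = 0 ∧ v = 0 := by
  by_cases hv : v = 0
  · subst hv; simp at e; exact ⟨e, rfl⟩
  · exfalso
    apply h
    refine ⟨-u / v, ?_⟩
    have : (v:ℝ) ≠ 0 := by exact_mod_cast hv
    push_cast; field_simp; linarith

lemma notin (d : ℕ) (hd : Irrational (√d)) (y : ℝ) (e f s : ℚ) (hs : s ≠ 0) (hy : y^2 = e + f * √d)
    (hn : e^2 - d * f^2 = s^2 * d) (A B C D : ℚ) (h : (A + B * √d) * y + (C + D * √d) = 0) : A = 0 ∧ B = 0 := by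
  have hd2 : √(d:ℝ) * √(d:ℝ) = d := mul_self_sqrt (Nat.cast_nonneg d)
  have h2 : (A + B * √d)^2 * y^2 = (C + D * √d)^2 := by
    have : (A + B * √d) * y = - (C + D * √d) := by linarith
    rw [← mul_pow, this, neg_sq]
  rw [hy] at h2
  have h3 := irr2 (√d) hd (A^2*e + d*B^2*e + 2*A*B*f*d - C^2 - d*D^2) (2*A*B*e + A^2*f + d * B^2*f - 2*C*D) (by
    push_cast
    linear_combination h2 - (B^2*e + 2*A*B*f + B^2*f*√d - D^2)*hd2)
  have k1 : (A^2 - d * B^2)^2 * (e^2 - d*f^2) = (C^2 - d*D^2)^2 := by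
    have g1 := h3.1
    have g2 := h3.2
    have g1' : A^2*e + d*B^2*e + 2*A*B*f*d = C^2 + d*D^2 := by linarith
    have g2' : 2*A*B*e + A^2*f + d * B^2*f = 2*C*D := by linarith
    have : (A^2*e + d*B^2*e + 2*A*B*f*d)^2 - d * (2*A*B*e + A^2*f + d * B^2*f)^2 = (C^2 + d*D^2)^2 - d * (2*C*D)^2 := by rw [g1', g2']
    linear_combination this
  rw [hn] at k1
  have k2 : ((A^2 - d * B^2) * s) ^ 2 * d = (C^2 - d*D^2)^2 := by linarith
  have k3 : (A^2 - d * B^2) * s = 0 := by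
    have r1 : |(((A^2 - d * B^2) * s : ℚ) : ℝ)| * √d = |((C^2 - d*D^2 : ℚ) : ℝ)| := by
      rw [← sqrt_sq_eq_abs, ← sqrt_sq_eq_abs, ← sqrt_mul (sq_nonneg _)]
      congr 1
      exact_mod_cast k2
    rw [← Rat.cast_abs, ← Rat.cast_abs] at r1
    have := irr2 (√d) hd (-|C^2 - d*D^2|) |(A^2 - d * B^2) * s| (by push_cast at r1 ⊢; linarith)
    exact abs_eq_zero.mp this.2
  have k4 : A^2 - d * B^2 = 0 := (mul_eq_zero.mp k3).resolve_right hs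
  have k5 : B = 0 := by
    have r1 : |(A:ℝ)| = |(B : ℝ)| * √d := by
      rw [← sqrt_sq_eq_abs, ← sqrt_sq_eq_abs, ← sqrt_mul (sq_nonneg _)]
      congr 1
      have : A^2 = B^2 * d := by linarith
      exact_mod_cast this
    rw [← Rat.cast_abs, ← Rat.cast_abs] at r1
    have := irr2 (√d) hd (-|A|) |B| (by push_cast at r1 ⊢; linarith)
    exact abs_eq_zero.mp this.2
  refine ⟨?_, k5⟩
  rw [k5] at k4
  simpa using k4

lemma Good.sideX (h : Good N ABC τ a b) : ∃ X : ℝ, 0 < X ∧ nsq (ABC 1 - ABC 0) = X^2 ∧ ∃ p q r : ℕ, X = p * a + q * b + r := by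
  have hp : 0 < nsq (ABC 1 - ABC 0) := normSq_pos _ (edge_ne ABC h.arpos.ne' 0)
  have e : nsq (ABC 1 - ABC 0) = (√(nsq (ABC 1 - ABC 0)))^2 := (sq_sqrt hp.le).symm
  exact ⟨√(nsq (ABC 1 - ABC 0)), sqrt_pos.mpr hp, e, _, _, _, h.side_len 0 _ (sqrt_pos.mpr hp) e⟩

lemma Good.special (h : Good N ABC τ a b) (i j : ℕ) (u : ℝ) (hu : arcsin a = i * u) (hv : π / 2 = (i + j) * u) :
    ∃ (X : ℝ) (p q r k : ℕ), 0 < X ∧ X = p * a + q * b + r ∧ N * (a * b) = X^2 * sin (2 * k * u) ∧ 0 < k ∧ k < i + j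
     ∧ ∃ p1 q1 r1 : ℕ, k = p1 * i + q1 * j + r1 * (i + j) := by
  obtain ⟨X, hX, hX2, p, q, r, e⟩ := h.sideX
  have hs := (h.sinA X hX hX2).1
  have hc := h.angle_corner 1
  have hsum := h.va_sum
  have hiso := h.va_iso
  have h0 := (h.angle_corner 0).2
  set k := pc τ 0 (ABC 1) * i + pc τ 1 (ABC 1) * j + pc τ 2 (ABC 1) * (i + j) with hk
  have hk2 : va ABC 1 = k * u := by
    rw [← hc.1, hk, hu, hv]; push_cast; ring
  have hup : 0 < u := by
    by_contra hcon; push Not at hcon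
    have : ((i:ℝ) + j) * u ≤ 0 := mul_nonpos_of_nonneg_of_nonpos (by positivity) hcon
    linarith [pi_pos]
  have e0 : va ABC 0 = π - 2 * k * u := by linarith
  rw [e0, sin_pi_sub] at hs
  refine ⟨X, p, q, r, k, hX, e, hs, ?_, ?_, _, _, _, hk⟩
  · have : (0:ℝ) < k := by
      by_contra hcon; push Not at hcon
      nlinarith [hc.2.1]
    exact_mod_cast this
  · have : (k:ℝ) < i + j := by
      by_contra hcon; push Not at hcon
      nlinarith [hc.2.1]
    exact_mod_cast this

lemma ir2 : Irrational (√((2:ℕ):ℝ)) := Nat.Prime.irrational_sqrt (by norm_num)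
lemma ir3 : Irrational (√((3:ℕ):ℝ)) := Nat.Prime.irrational_sqrt (by norm_num)
lemma ir5 : Irrational (√((5:ℕ):ℝ)) := Nat.Prime.irrational_sqrt (by norm_num)

lemma two_sq (r : ℕ) (h : N = 2 * r^2) : Concl N := Or.inr (Or.inl ⟨r, r, by rw [h]; ring⟩)

lemma Good.sp4 (h : Good N ABC τ a b) (hx : arcsin a = π / 2 * (1/2)) : Concl N := by
  obtain ⟨X, p, q, r, k, hX, e, hs, hk, hk2, -⟩ := h.special 1 1 (π/4) (by rw [hx]; push_cast; ring) (by push_cast; ring)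
  have k1 : k = 1 := by omega
  subst k1
  have hA : arcsin a = π / 4 := by rw [hx]; ring
  have ha : a = √((2:ℕ):ℝ) / 2 := by rw [← h.sina, hA, sin_pi_div_four]; norm_num
  have hb : b = √((2:ℕ):ℝ) / 2 := by rw [← h.cosa, hA, cos_pi_div_four]; norm_num
  have hs1 : sin (2 * (1:ℕ) * (π/4)) = 1 := by rw [← sin_pi_div_two]; congr 1; push_cast; ring
  rw [hs1, e, ha, hb] at hs
  have hd : √((2:ℕ):ℝ) * √((2:ℕ):ℝ) = 2 := by rw [mul_self_sqrt] <;> norm_num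
  obtain ⟨e1, e2⟩ := irr2 _ ir2 ((N:ℚ) - (p+q)^2 - 2 * r^2) (-2*(p+q)*r) (by
    push_cast at hs hd ⊢
    linear_combination 2 * hs + (-(N:ℝ)/2 + (p+q)^2/2) * hd)
  have e2' : (p + q) * r = 0 := by
    have : (((p + q) * r : ℕ) : ℚ) = 0 := by push_cast; linarith
    exact_mod_cast this
  have e1' : N = (p+q)^2 + 2 * r^2 := by
    have : (N : ℚ) = ((p+q)^2 + 2 * r^2 : ℕ) := by push_cast; linarith
    exact_mod_cast this
  rcases mul_eq_zero.mp e2' with h0 | h0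
  · rw [h0] at e1'; exact two_sq r (by simpa using e1')
  · rw [h0] at e1'; left; exact ⟨p+q, by simpa using e1'⟩

lemma Good.sp6 (h : Good N ABC τ a b) (hx : arcsin a = π / 2 * (1/3)) : Concl N := by
  obtain ⟨X, p, q, r, k, hX, e, hs, hk, hk2, -⟩ := h.special 1 2 (π/6) (by rw [hx]; push_cast; ring) (by push_cast; ring)
  have hA : arcsin a = π / 6 := by rw [hx]; ring
  have ha : a = 1 / 2 := by rw [← h.sina, hA, sin_pi_div_six]
  have hb : b = √((3:ℕ):ℝ) / 2 := by rw [← h.cosa, hA, cos_pi_div_six]; norm_num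
  have hs1 : sin (2 * k * (π/6)) = √((3:ℕ):ℝ) / 2 := by
    rcases (by omega : k = 1 ∨ k = 2) with rfl | rfl
    · have : (2 * ((1:ℕ):ℝ) * (π/6)) = π / 3 := by push_cast; ring
      rw [this, sin_pi_div_three]; norm_num
    · have : (2 * ((2:ℕ):ℝ) * (π/6)) = π - π / 3 := by push_cast; ring
      rw [this, sin_pi_sub, sin_pi_div_three]; norm_num
  rw [hs1, ha, hb] at hs
  have h3 : 0 < √((3:ℕ):ℝ) := by positivity
  have hs' : (N:ℝ) = 2 * X^2 := by
    have : √((3:ℕ):ℝ) * N = √((3:ℕ):ℝ) * (2 * X^2) := by linear_combination 4 * hs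
    exact mul_left_cancel₀ h3.ne' this
  rw [e, ha, hb] at hs'
  have hd : √((3:ℕ):ℝ) * √((3:ℕ):ℝ) = 3 := by rw [mul_self_sqrt] <;> norm_num
  obtain ⟨e1, e2⟩ := irr2 _ ir3 (2*(N:ℚ) - (p+2*r)^2 - 3 * q^2) (-2*(p+2*r)*q) (by
    push_cast at hs' hd ⊢
    linear_combination 2 * hs' + q^2 * hd)
  have e2' : (p + 2*r) * q = 0 := by
    have : (((p + 2*r) * q : ℕ) : ℚ) = 0 := by push_cast; linarith
    exact_mod_cast this
  have e1' : 2*N = (p+2*r)^2 + 3 * q^2 := by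
    have : ((2*N : ℕ) : ℚ) = ((p+2*r)^2 + 3 * q^2 : ℕ) := by push_cast; linarith
    exact_mod_cast this
  rcases mul_eq_zero.mp e2' with h0 | h0
  · rw [h0] at e1'
    have : Even (q^2) := by
      have : Even (3 * q^2) := ⟨N, by omega⟩
      rcases Nat.even_mul.mp this with h | h
      · exact absurd h (by decide)
      · exact h
    obtain ⟨t, ht⟩ := (Nat.even_pow.mp this).1
    right; right
    exact ⟨t, by rw [ht] at e1'; nlinarith⟩
  · rw [h0] at e1'
    have : Even ((p+2*r)^2) := ⟨N, by omega⟩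
    obtain ⟨t, ht⟩ := (Nat.even_pow.mp this).1
    exact two_sq t (by rw [ht] at e1'; nlinarith)

lemma Good.sp8 (h : Good N ABC τ a b) (hx : arcsin a = π / 2 * (1/4)) : Concl N := by
  obtain ⟨X, p, q, r, k, hX, e, hs, hk, hk2, -⟩ := h.special 1 3 (π/8) (by rw [hx]; push_cast; ring) (by push_cast; ring)
  have hA : arcsin a = π / 8 := by rw [hx]; ring
  have ha : a = sin (π/8) := by rw [← hA, h.sina]
  have hb : b = cos (π/8) := by rw [← hA, h.cosa]
  have h2p : 0 < √((2:ℕ):ℝ) := by positivity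
  have hd : √((2:ℕ):ℝ) * √((2:ℕ):ℝ) = 2 := by rw [mul_self_sqrt] <;> norm_num
  have hab : a * b = √((2:ℕ):ℝ) / 4 := by
    have := sin_two_mul (π/8)
    rw [show 2 * (π/8) = π/4 by ring, sin_pi_div_four, ← ha, ← hb] at this
    push_cast; linarith
  have hdiff : b^2 - a^2 = √((2:ℕ):ℝ) / 2 := by
    have := cos_two_mul' (π/8)
    rw [show 2 * (π/8) = π/4 by ring, cos_pi_div_four, ← ha, ← hb] at this
    push_cast; linarith
  have ha2 : a^2 = (2 - √((2:ℕ):ℝ)) / 4 := by linarith [h.sq]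
  have hba : b = a * (1 + √((2:ℕ):ℝ)) := by
    apply mul_left_cancel₀ h.apos.ne'
    rw [hab]; linear_combination -(1 + √((2:ℕ):ℝ)) * ha2 + hd/4
  have hN : (0:ℝ) < N := by
    by_contra hc
    have : (N:ℝ) = 0 := le_antisymm (not_lt.mp hc) (Nat.cast_nonneg _)
    have har := h.area
    rw [this] at har; linarith [h.arpos]
  have hX2 : ∃ g l : ℚ, X^2 = N * (g + l * √((2:ℕ):ℝ)) ∧ ((g = 1/2 ∧ l = 0) ∨ (g = 0 ∧ l = 1/4)) := by
    rw [hab] at hs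
    rcases (by omega : k = 1 ∨ k = 2 ∨ k = 3) with rfl | rfl | rfl
    · refine ⟨1/2, 0, ?_, Or.inl ⟨rfl, rfl⟩⟩
      rw [show (2 * ((1:ℕ):ℝ) * (π/8)) = π / 4 by push_cast; ring, sin_pi_div_four] at hs
      apply mul_left_cancel₀ h2p.ne'
      push_cast at hs ⊢; linarith
    · refine ⟨0, 1/4, ?_, Or.inr ⟨rfl, rfl⟩⟩
      rw [show (2 * ((2:ℕ):ℝ) * (π/8)) = π / 2 by push_cast; ring, sin_pi_div_two] at hs
      push_cast at hs ⊢; linarith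
    · refine ⟨1/2, 0, ?_, Or.inl ⟨rfl, rfl⟩⟩
      rw [show (2 * ((3:ℕ):ℝ) * (π/8)) = π - π / 4 by push_cast; ring, sin_pi_sub, sin_pi_div_four] at hs
      apply mul_left_cancel₀ h2p.ne'
      push_cast at hs ⊢; linarith
  obtain ⟨g, l, hXX, hgl⟩ := hX2
  have hN' : (0:ℚ) < N := by exact_mod_cast hN
  have eX : X = a * ((p + q : ℕ) + q * √((2:ℕ):ℝ)) + r := by rw [e, hba]; push_cast; ring
  generalize p + q = m at eX
  rw [eX] at hXX
  obtain ⟨n1, n2⟩ := notin 2 ir2 a (1/2) (-1/4) (1/4) (by norm_num) (by rw [ha2]; push_cast; ring) (by norm_num)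
    (2*r*m) (2*r*q) (r^2 + m^2/2 + q^2 - m*q - N * g) (m*q - m^2/4 - q^2/2 - N * l) (by
      push_cast at hXX ha2 hd ⊢
      linear_combination hXX - (m + q * √2)^2 * ha2 + (-q^2/2 + m*q/2 + √2*q^2/4) * hd)
  have n1' : r * m = 0 := by
    have : ((r * m : ℕ) : ℚ) = 0 := by push_cast; linarith
    exact_mod_cast this
  have n2' : r * q = 0 := by
    have : ((r * q : ℕ) : ℚ) = 0 := by push_cast; linarith
    exact_mod_cast this
  by_cases hr : r = 0
  · exfalso
    subst hr
    obtain ⟨e1, e2⟩ := irr2 _ ir2 (m^2/2 + q^2 - m*q - N * g) (m*q - m^2/4 - q^2/2 - N * l) (by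
      push_cast at hXX ha2 hd ⊢
      linear_combination hXX - (m + q * √2)^2 * ha2 + (-q^2/2 + m*q/2 + √2*q^2/4) * hd)
    rcases hgl with ⟨rfl, rfl⟩ | ⟨rfl, rfl⟩
    · have : ((m:ℝ) - 2 * q)^2 = (q * √((2:ℕ):ℝ))^2 := by
        have : ((m:ℚ) - 2*q)^2 = 2 * q^2 := by linarith
        have : ((m:ℝ) - 2*q)^2 = 2 * q^2 := by exact_mod_cast this
        rw [this]; linear_combination - (q:ℝ)^2 * hd
      rcases sq_eq_sq_iff_eq_or_eq_neg.mp this with h1 | h1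
      · obtain ⟨z1, z2⟩ := irr2 _ ir2 (m - 2*q) (-q) (by push_cast at h1 ⊢; linarith)
        have : (q:ℚ) = 0 := by linarith
        rw [this] at e1 z1
        have : (m:ℚ) = 0 := by linarith
        rw [this] at e1; linarith
      · obtain ⟨z1, z2⟩ := irr2 _ ir2 (m - 2*q) (q) (by push_cast at h1 ⊢; linarith)
        rw [z2] at e1 z1
        have : (m:ℚ) = 0 := by linarith
        rw [this] at e1; linarith
    · have z1 : (q:ℚ)^2 + (m - q)^2 = 0 := by linarith
      have : (q:ℚ) = 0 := by nlinarith [sq_nonneg (q:ℚ), sq_nonneg ((m:ℚ)-q)]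
      rw [this] at z1 e2
      have : (m:ℚ) = 0 := by nlinarith
      rw [this] at e2; linarith
  · have hm : m = 0 := (mul_eq_zero.mp n1').resolve_left hr
    have hq : q = 0 := (mul_eq_zero.mp n2').resolve_left hr
    subst hm; subst hq
    obtain ⟨e1, e2⟩ := irr2 _ ir2 (r^2 - N * g) (- N * l) (by
      push_cast at hXX ⊢
      linear_combination hXX)
    rcases hgl with ⟨rfl, rfl⟩ | ⟨rfl, rfl⟩
    · apply two_sq r
      have : (N : ℚ) = (2 * r^2 : ℕ) := by push_cast; linarith
      exact_mod_cast this
    · exfalso; linarith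

end

section
open EuclideanGeometry Real
open scoped Topology
variable {N : ℕ} {ABC : Tri} {τ : Fin N → Tri} {a b : ℝ}

lemma Good.Npos (h : Good N ABC τ a b) : (0:ℝ) < N := by
  by_contra hc
  have : (N:ℝ) = 0 := le_antisymm (not_lt.mp hc) (Nat.cast_nonneg _)
  have har := h.area
  rw [this] at har; linarith [h.arpos]

lemma Good.sp10 (h : Good N ABC τ a b) (hx : arcsin a = π / 2 * (1/5)) : Concl N := by
  obtain ⟨X, p, q, r, k, hX, e, hs, hk, hk2, -⟩ := h.special 1 4 (π/10) (by rw [hx]; push_cast; ring) (by push_cast; ring)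
  have hA : arcsin a = π / 10 := by rw [hx]; ring
  have ha : a = sin (π/10) := by rw [← hA, h.sina]
  have hb : b = cos (π/10) := by rw [← hA, h.cosa]
  have h5p : 0 < √((5:ℕ):ℝ) := by positivity
  have hd : √((5:ℕ):ℝ) * √((5:ℕ):ℝ) = 5 := by rw [mul_self_sqrt] <;> norm_num
  have h51 : 1 < √((5:ℕ):ℝ) := by nlinarith
  have hc : cos (π/5) = (1 + √((5:ℕ):ℝ)) / 4 := by rw [cos_pi_div_five]; norm_num
  have hab : a * b = sin (π/5) / 2 := by
    have := sin_two_mul (π/10)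
    rw [show 2 * (π/10) = π/5 by ring, ← ha, ← hb] at this
    linarith
  have hdiff : b^2 - a^2 = (1 + √((5:ℕ):ℝ)) / 4 := by
    have := cos_two_mul' (π/10)
    rw [show 2 * (π/10) = π/5 by ring, ← ha, ← hb, hc] at this
    linarith
  have hb2 : b^2 = (5 + √((5:ℕ):ℝ)) / 8 := by linarith [h.sq]
  have ha1 : a = (√((5:ℕ):ℝ) - 1) / 4 := by
    have h1 : a^2 = ((√((5:ℕ):ℝ) - 1) / 4)^2 := by linear_combination h.sq - hb2 - hd/16
    rcases sq_eq_sq_iff_eq_or_eq_neg.mp h1 with h2 | h2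
    · exact h2
    · exfalso; have h3 := h.apos; rw [h2] at h3; push_cast at h3 h51; linarith
  have hS : 0 < sin (π/5) := by have := mul_pos h.apos h.bpos; linarith
  have hN : (0:ℚ) < N := by exact_mod_cast h.Npos
  have hX2 : ∃ g l : ℚ, X^2 = N * (g + l * √((5:ℕ):ℝ)) ∧ ((g = 1/2 ∧ l = 0) ∨ (g = -1/4 ∧ l = 1/4)) := by
    rw [hab] at hs
    have m1 : (N:ℝ) * (sin (π/5)/2) = X^2 * sin (π/5) → X^2 = N * (((1/2:ℚ):ℝ) + ((0:ℚ):ℝ) * √((5:ℕ):ℝ)) := by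
      intro hs
      apply mul_left_cancel₀ hS.ne'
      push_cast; linarith
    have m2 : (N:ℝ) * (sin (π/5)/2) = X^2 * (2 * sin (π/5) * cos (π/5)) → X^2 = N * (((-1/4:ℚ):ℝ) + ((1/4:ℚ):ℝ) * √((5:ℕ):ℝ)) := by
      intro hs
      rw [hc] at hs
      have : (N:ℝ) = X^2 * (1 + √((5:ℕ):ℝ)) := by
        apply mul_left_cancel₀ hS.ne'
        linarith
      rw [this]
      push_cast at hd ⊢; linear_combination - X^2/4 * hd
    rcases (by omega : k = 1 ∨ k = 2 ∨ k = 3 ∨ k = 4) with rfl | rfl | rfl | rfl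
    · refine ⟨1/2, 0, m1 ?_, Or.inl ⟨rfl, rfl⟩⟩
      rw [show (2 * ((1:ℕ):ℝ) * (π/10)) = π / 5 by push_cast; ring] at hs
      exact hs
    · refine ⟨-1/4, 1/4, m2 ?_, Or.inr ⟨rfl, rfl⟩⟩
      rw [show (2 * ((2:ℕ):ℝ) * (π/10)) = 2 * (π / 5) by push_cast; ring, sin_two_mul] at hs
      exact hs
    · refine ⟨-1/4, 1/4, m2 ?_, Or.inr ⟨rfl, rfl⟩⟩
      rw [show (2 * ((3:ℕ):ℝ) * (π/10)) = π - 2 * (π / 5) by push_cast; ring, sin_pi_sub, sin_two_mul] at hs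
      exact hs
    · refine ⟨1/2, 0, m1 ?_, Or.inl ⟨rfl, rfl⟩⟩
      rw [show (2 * ((4:ℕ):ℝ) * (π/10)) = π - π / 5 by push_cast; ring, sin_pi_sub] at hs
      exact hs
  obtain ⟨g, l, hXX, hgl⟩ := hX2
  obtain ⟨A, hAd⟩ : ∃ A : ℚ, A = p / 4 := ⟨_, rfl⟩
  obtain ⟨B, hBd⟩ : ∃ B : ℚ, B = r - p / 4 := ⟨_, rfl⟩
  have eX : X = q * b + (B + A * √((5:ℕ):ℝ)) := by rw [e, ha1, hAd, hBd]; push_cast; ring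
  rw [eX] at hXX
  obtain ⟨n1, n2⟩ := notin 5 ir5 b (5/8) (1/8) (1/4) (by norm_num) (by rw [hb2]; push_cast; ring) (by norm_num)
    (2*q*B) (2*q*A) (q^2*5/8 + 5 * A^2 + B^2 - N * g) (q^2/8 + 2 * A * B - N * l) (by
      push_cast at hXX hb2 hd ⊢
      linear_combination hXX - q^2 * hb2 - A^2 * hd)
  by_cases hq : q = 0
  · subst hq
    obtain ⟨e1, e2⟩ := irr2 _ ir5 (5 * A^2 + B^2 - N * g) (2 * A * B - N * l) (by
      push_cast at hXX hb2 hd ⊢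
      linear_combination hXX - A^2 * hd)
    rcases hgl with ⟨rfl, rfl⟩ | ⟨rfl, rfl⟩
    · have : A * B = 0 := by linarith
      rcases mul_eq_zero.mp this with h0 | h0
      · apply two_sq r
        have hp : (p:ℚ) = 0 := by linarith
        rw [h0, hBd, hp] at e1
        have : (N : ℚ) = (2 * r^2 : ℕ) := by push_cast; linarith
        exact_mod_cast this
      · right; left
        refine ⟨3 * r, r, ?_⟩
        have hp : A = r := by linarith
        rw [h0, hp] at e1
        have : (N : ℚ) = ((3 * r)^2 + r^2 : ℕ) := by push_cast; linarith
        exact_mod_cast this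
    · exfalso; nlinarith [sq_nonneg A, sq_nonneg B]
  · exfalso
    have hq' : (q:ℚ) ≠ 0 := by exact_mod_cast hq
    have hq2 : 0 < (q:ℚ)^2 := by positivity
    have hB0 : B = 0 := by simpa [hq] using n1
    have hA0 : A = 0 := by simpa [hq] using n2
    rw [hA0, hB0] at hXX
    obtain ⟨e1, e2⟩ := irr2 _ ir5 (q^2*5/8 - N * g) (q^2/8 - N * l) (by
      push_cast at hXX hb2 hd ⊢
      linear_combination hXX - q^2 * hb2)
    rcases hgl with ⟨rfl, rfl⟩ | ⟨rfl, rfl⟩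
    · linarith
    · linarith

lemma Good.sp5 (h : Good N ABC τ a b) (hx : arcsin a = π / 2 * (2/5)) : Concl N := by
  obtain ⟨X, p, q, r, k, hX, e, hs, hk, hk2, p1, q1, r1, hkk⟩ := h.special 2 3 (π/10) (by rw [hx]; push_cast; ring) (by push_cast; ring)
  have hA : arcsin a = π / 5 := by rw [hx]; ring
  have ha : a = sin (π/5) := by rw [← hA, h.sina]
  have hb : b = cos (π/5) := by rw [← hA, h.cosa]
  have hd : √((5:ℕ):ℝ) * √((5:ℕ):ℝ) = 5 := by rw [mul_self_sqrt] <;> norm_num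
  have hb1 : b = (1 + √((5:ℕ):ℝ)) / 4 := by rw [hb, cos_pi_div_five]; norm_num
  have ha2 : a^2 = (5 - √((5:ℕ):ℝ)) / 8 := by
    have := h.sq
    rw [hb1] at this
    linear_combination this - hd / 16
  have hab : 0 < a * b := mul_pos h.apos h.bpos
  have hN : (0:ℚ) < N := by exact_mod_cast h.Npos
  have hX2 : ∃ g l : ℚ, X^2 = N * (g + l * √((5:ℕ):ℝ)) ∧ ((g = 1/2 ∧ l = 0) ∨ (g = 1/4 ∧ l = 1/4)) := by
    have m1 : (N:ℝ) * (a * b) = X^2 * (2 * a * b) → X^2 = N * (((1/2:ℚ):ℝ) + ((0:ℚ):ℝ) * √((5:ℕ):ℝ)) := by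
      intro hs
      apply mul_left_cancel₀ hab.ne'
      push_cast; linarith
    rcases (by omega : k = 2 ∨ k = 3 ∨ k = 4) with rfl | rfl | rfl
    · refine ⟨1/2, 0, m1 ?_, Or.inl ⟨rfl, rfl⟩⟩
      rw [show (2 * ((2:ℕ):ℝ) * (π/10)) = 2 * (π / 5) by push_cast; ring, sin_two_mul, ← ha, ← hb] at hs
      exact hs
    · refine ⟨1/2, 0, m1 ?_, Or.inl ⟨rfl, rfl⟩⟩
      rw [show (2 * ((3:ℕ):ℝ) * (π/10)) = π - 2 * (π / 5) by push_cast; ring, sin_pi_sub, sin_two_mul, ← ha, ← hb] at hs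
      exact hs
    · refine ⟨1/4, 1/4, ?_, Or.inr ⟨rfl, rfl⟩⟩
      rw [show (2 * ((4:ℕ):ℝ) * (π/10)) = π - π / 5 by push_cast; ring, sin_pi_sub, ← ha] at hs
      have : (N:ℝ) * b = X^2 := by
        apply mul_left_cancel₀ h.apos.ne'
        linarith
      rw [← this, hb1]; push_cast; ring
  obtain ⟨g, l, hXX, hgl⟩ := hX2
  obtain ⟨A, hAd⟩ : ∃ A : ℚ, A = q / 4 := ⟨_, rfl⟩
  obtain ⟨B, hBd⟩ : ∃ B : ℚ, B = r + q / 4 := ⟨_, rfl⟩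
  have eX : X = p * a + (B + A * √((5:ℕ):ℝ)) := by rw [e, hb1, hAd, hBd]; push_cast; ring
  rw [eX] at hXX
  obtain ⟨n1, n2⟩ := notin 5 ir5 a (5/8) (-1/8) (1/4) (by norm_num) (by rw [ha2]; push_cast; ring) (by norm_num)
    (2*p*B) (2*p*A) (p^2*5/8 + 5 * A^2 + B^2 - N * g) (-p^2/8 + 2 * A * B - N * l) (by
      push_cast at hXX ha2 hd ⊢
      linear_combination hXX - p^2 * ha2 - A^2 * hd)
  by_cases hp : p = 0
  · subst hp
    obtain ⟨e1, e2⟩ := irr2 _ ir5 (5 * A^2 + B^2 - N * g) (2 * A * B - N * l) (by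
      push_cast at hXX ha2 hd ⊢
      linear_combination hXX - A^2 * hd)
    have hr0 : (0:ℚ) ≤ r := Nat.cast_nonneg _
    have hq0 : (0:ℚ) ≤ q := Nat.cast_nonneg _
    rcases hgl with ⟨rfl, rfl⟩ | ⟨rfl, rfl⟩
    · have : A * B = 0 := by linarith
      have hA0 : A = 0 := by
        rcases mul_eq_zero.mp this with h0 | h0
        · exact h0
        · linarith
      apply two_sq r
      have hp : (q:ℚ) = 0 := by linarith
      rw [hA0, hBd, hp] at e1
      have : (N : ℚ) = (2 * r^2 : ℕ) := by push_cast; linarith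
      exact_mod_cast this
    · exfalso
      have hA0 : A = 0 := by nlinarith [sq_nonneg A, sq_nonneg (A-B)]
      rw [hA0] at e2; linarith
  · exfalso
    have hq' : (p:ℚ) ≠ 0 := by exact_mod_cast hp
    have hq2 : 0 < (p:ℚ)^2 := by positivity
    have hB0 : B = 0 := by simpa [hp] using n1
    have hA0 : A = 0 := by simpa [hp] using n2
    rw [hA0, hB0] at hXX
    obtain ⟨e1, e2⟩ := irr2 _ ir5 (p^2*5/8 - N * g) (-p^2/8 - N * l) (by
      push_cast at hXX ha2 hd ⊢
      linear_combination hXX - p^2 * ha2)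
    rcases hgl with ⟨rfl, rfl⟩ | ⟨rfl, rfl⟩
    · linarith
    · linarith

end

section
open EuclideanGeometry Real
open scoped Topology
variable {N : ℕ} {ABC : Tri} {τ : Fin N → Tri} {a b : ℝ}

lemma sum_sq_of (N q u v : ℕ) (hN : N ≠ 0) (hq : q ≠ 0) (e : 2 * N * q^2 = u^2 + v^2) : ∃ x y : ℕ, N = x^2 + y^2 := by
  rw [Nat.eq_sq_add_sq_iff]
  intro l hl hl3
  have hp : l.Prime := Nat.prime_of_mem_primeFactors hl
  haveI : Fact l.Prime := ⟨hp⟩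
  have hl2 : l ∣ 2 * N * q^2 := (Nat.dvd_of_mem_primeFactors hl).trans ⟨2 * q^2, by ring⟩
  have h0 : 2 * N * q^2 ≠ 0 := by positivity
  have h1 := Nat.eq_sq_add_sq_iff.mp ⟨u, v, e⟩ l (Nat.mem_primeFactors.mpr ⟨hp, hl2, h0⟩) hl3
  rw [padicValNat.mul (by positivity) (by positivity), padicValNat.mul (by norm_num) hN, padicValNat.pow] at h1
  have h2 : padicValNat l 2 = 0 := by
    apply padicValNat.eq_zero_of_not_dvd
    intro hd
    have := (Nat.prime_dvd_prime_iff_eq hp Nat.prime_two).mp hd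
    omega
  rw [h2] at h1
  rcases h1 with ⟨t, ht⟩
  exact ⟨t - padicValNat l q, by omega⟩

open Polynomial in
lemma conj_exists (s : ℝ) (c : ℚ) (hs : Irrational s) (hc : s^2 = c) :
    ∃ (K : Subfield ℝ) (f : ℝ →+ ℝ), s ∈ K ∧ f 1 = 1 ∧ (∀ k ∈ K, ∀ t, f (k * t) = f k * f t) ∧ f s = -s := by
  have hm : (X^2 - C c : ℚ[X]).Monic := monic_X_pow_sub_C c (by norm_num)
  have hint : IsIntegral ℚ s := ⟨X^2 - C c, hm, by simp [hc]⟩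
  have hroot : (-s) ∈ (minpoly ℚ s).aroots ℝ := by
    rw [mem_aroots]
    refine ⟨minpoly.ne_zero hint, ?_⟩
    have e := modByMonic_add_div (minpoly ℚ s) (X^2 - C c)
    have hd1 : (minpoly ℚ s %ₘ (X^2 - C c)).natDegree ≤ 1 := by
      have := natDegree_modByMonic_lt (minpoly ℚ s) hm (by
        intro h1
        have := congrArg natDegree h1
        rw [natDegree_X_pow_sub_C, natDegree_one] at this
        omega)
      rw [natDegree_X_pow_sub_C] at this
      omega
    obtain ⟨u, v, huv⟩ := exists_eq_X_add_C_of_natDegree_le_one hd1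
    have h0 : aeval s (minpoly ℚ s) = 0 := minpoly.aeval ℚ s
    rw [← e, huv] at h0
    simp [hc] at h0
    obtain ⟨h1, h2⟩ := irr2 s hs v u (by linarith)
    rw [← e, huv, h1, h2]
    simp [hc]
  let σ := (IntermediateField.algHomAdjoinIntegralEquiv ℚ hint).symm ⟨-s, hroot⟩
  have hσ : σ (IntermediateField.AdjoinSimple.gen ℚ s) = -s :=
    IntermediateField.algHomAdjoinIntegralEquiv_symm_apply_gen ℚ hint ⟨-s, hroot⟩
  let K := IntermediateField.adjoin ℚ {s}
  obtain ⟨g, hg⟩ := LinearMap.exists_leftInverse_of_injective (Algebra.linearMap K ℝ)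
    (LinearMap.ker_eq_bot.mpr (algebraMap K ℝ).injective)
  have hg' : ∀ k : K, g (k : ℝ) = k := fun k => LinearMap.congr_fun hg k
  refine ⟨K.toSubfield, (σ : K →+* ℝ).toAddMonoidHom.comp g.toAddMonoidHom, ?_, ?_, ?_, ?_⟩
  · exact IntermediateField.mem_adjoin_simple_self ℚ s
  · show σ (g 1) = 1
    have := hg' 1
    rw [show (((1 : K) : K) : ℝ) = 1 from rfl] at this
    rw [this, map_one]
  · intro k hk t
    show σ (g (k * t)) = σ (g k) * σ (g t)
    have h1 : g (k * t) = (⟨k, hk⟩ : K) * g t := g.map_smul (⟨k, hk⟩ : K) t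
    have h2 : g k = (⟨k, hk⟩ : K) := hg' ⟨k, hk⟩
    rw [h1, h2, map_mul]
  · show σ (g s) = -s
    rw [← hσ]
    congr 1
    exact hg' (IntermediateField.AdjoinSimple.gen ℚ s)

lemma pc_pos (j : Fin 3) (i : Fin N) (z : Pt) (h : τ i j = z) : pc τ j z ≠ 0 := by
  classical
  unfold pc
  apply Finset.card_ne_zero.mpr
  exact ⟨i, by simp [h]⟩

lemma cnt_pos (k j : Fin 3) (i : Fin N) (h : onS ABC τ k i j) : cnt ABC τ k j ≠ 0 := by
  classical
  unfold cnt
  apply Finset.card_ne_zero.mpr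
  exact ⟨i, by simp [h]⟩

lemma cnt_ex (k j : Fin 3) (h : cnt ABC τ k j ≠ 0) : ∃ i, onS ABC τ k i j := by
  classical
  unfold cnt at h
  obtain ⟨i, hi⟩ := Finset.card_ne_zero.mp h
  exact ⟨i, by simpa using hi⟩

lemma Good.generic (h : Good N ABC τ a b)
   (hg : pc τ 0 (ABC 0) = 2 ∧ pc τ 1 (ABC 0) = 0 ∧ pc τ 2 (ABC 0) = 0 ∧ pc τ 0 (ABC 1) = 0 ∧ pc τ 1 (ABC 1) = 1 ∧ pc τ 2 (ABC 1) = 0) :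
   Concl N := by
  obtain ⟨g00, g10, g20, g01, g11, g21⟩ := hg
  have apos := h.apos
  have bpos := h.bpos
  obtain ⟨s, hs0, hs2, -⟩ := h.sideX
  obtain ⟨hN, hBC⟩ := h.sinA s hs0 hs2
  have hA : va ABC 0 = 2 * arcsin a := by
    have := (h.angle_corner 0).1
    rw [g00, g10, g20] at this; push_cast at this; linarith
  rw [hA, sin_two_mul, h.sina, h.cosa] at hN
  rw [hA, cos_two_mul, h.cosa] at hBC
  have hN2 : (N:ℝ) = 2 * s^2 := by
    apply mul_left_cancel₀ (mul_pos apos bpos).ne'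
    linarith
  have hNpos := h.Npos
  have hBC2 : nsq (ABC 2 - ABC 1) = (2 * s * a)^2 := by
    rw [hBC]; linear_combination -4 * s^2 * h.sq
  have hL : 0 < 2 * s * a := by positivity
  have e1 := h.side_len 0 s hs0 hs2
  have e2 := h.side_len 1 (2*s*a) hL hBC2
  have cA : cnt ABC τ 0 2 ≠ 0 ∨ cnt ABC τ 0 0 ≠ 0 := by
    obtain ⟨i, j, ho, hv⟩ := h.side_corner0 0
    fin_cases j
    · right; exact cnt_pos _ _ i ho
    · exfalso
      rcases hv with hv | hv
      · exact pc_pos 1 i _ hv g10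
      · exact pc_pos 2 i _ hv g20
    · left; exact cnt_pos _ _ i ho
  have cB : cnt ABC τ 0 1 ≠ 0 ∨ cnt ABC τ 0 0 ≠ 0 := by
    obtain ⟨i, j, ho, hv⟩ := h.side_corner1 0
    fin_cases j
    · right; exact cnt_pos _ _ i ho
    · left; exact cnt_pos _ _ i ho
    · exfalso
      rcases hv with hv | hv
      · exact pc_pos 2 i _ hv g21
      · exact pc_pos 0 i _ hv g01
  have x00 := cnt_ex (ABC := ABC) (τ := τ) 0 0
  have x01 := cnt_ex (ABC := ABC) (τ := τ) 0 1
  have x02 := cnt_ex (ABC := ABC) (τ := τ) 0 2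
  have x11 := cnt_ex (ABC := ABC) (τ := τ) 1 1
  have x12 := cnt_ex (ABC := ABC) (τ := τ) 1 2
  generalize cnt ABC τ 0 0 = r at *
  generalize cnt ABC τ 0 1 = p at *
  generalize cnt ABC τ 0 2 = q at *
  generalize cnt ABC τ 1 0 = r' at *
  generalize cnt ABC τ 1 1 = p' at *
  generalize cnt ABC τ 1 2 = q' at *
  by_cases hirr : Irrational s
  swap
  · have : ¬ Irrational (√((2*N : ℕ):ℝ)) := by
      have e : √((2*N : ℕ):ℝ) = 2 * s := by
        rw [show ((2*N : ℕ):ℝ) = (2*s)^2 by push_cast; rw [hN2]; ring, sqrt_sq (by positivity)]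
      rw [e]
      intro hi
      apply hirr
      rw [show (2:ℝ) * s = ((2:ℕ):ℝ) * s by norm_num] at hi
      exact (irrational_natCast_mul_iff.mp hi).2
    rw [irrational_sqrt_natCast_iff, not_not] at this
    obtain ⟨t, ht⟩ := this
    have hev : Even (t * t) := ⟨N, by omega⟩
    have : Even t := by
      rcases Nat.even_mul.mp hev with h | h <;> exact h
    obtain ⟨w, hw⟩ := this
    apply two_sq w
    rw [hw] at ht; nlinarith
  have hs2c : s^2 = ((N / 2 : ℚ) : ℝ) := by push_cast; linarith
  obtain ⟨K, f, hsK, f1, fm, fs⟩ := conj_exists s (N/2) hirr hs2c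
  have natK : ∀ n : ℕ, (n:ℝ) ∈ K := fun n => natCast_mem K n
  have h2K : (2:ℝ) ∈ K := by exact_mod_cast natK 2
  have hD : (p:ℝ) * q' - q * (p' - 2 * s) ≠ 0 := by
    intro h0
    obtain ⟨z1, z2⟩ := irr2 s hirr (p*q' - q*p') (2*q) (by push_cast; linarith)
    have hq : (q:ℚ) = 0 := by linarith
    have hq0 : q = 0 := by exact_mod_cast hq
    rw [hq] at z1
    have hr : r ≠ 0 := by
      rcases cA with h1 | h1
      · exact absurd hq0 h1
      · exact h1
    have hpq : p * q' = 0 := by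
      have : ((p * q' : ℕ) : ℚ) = 0 := by push_cast; linarith
      exact_mod_cast this
    subst hq0
    rcases mul_eq_zero.mp hpq with h1 | h1
    · subst h1
      apply hirr
      exact ⟨r, by rw [e1]; simp⟩
    · subst h1
      have k1 : (2 * s - p') * (s - r) = r' * p := by
        push_cast at e1 e2
        linear_combination (2 * s - p') * e1 + p * e2
      obtain ⟨z3, z4⟩ := irr2 s hirr (N + p' * r - r' * p) (-(2 * r + p')) (by
        push_cast; rw [hN2]; linarith)
      have : ((2 * r + p' : ℕ) : ℚ) = 0 := by push_cast; linarith
      have : 2 * r + p' = 0 := by exact_mod_cast this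
      omega
  have hDK : (p:ℝ) * q' - q * (p' - 2 * s) ∈ K :=
    sub_mem (mul_mem (natK _) (natK _)) (mul_mem (natK _) (sub_mem (natK _) (mul_mem h2K hsK)))
  have haK : a ∈ K := by
    have : a = ((s - r) * q' + q * r') / ((p:ℝ) * q' - q * (p' - 2 * s)) := by
      rw [eq_div_iff hD]
      linear_combination -q' * e1 + q * e2
    rw [this]
    exact div_mem (add_mem (mul_mem (sub_mem hsK (natK _)) (natK _)) (mul_mem (natK _) (natK _))) hDK
  have hbK : b ∈ K := by
    have : b = (- (p:ℝ) * r' - (p' - 2 * s) * (s - r)) / ((p:ℝ) * q' - q * (p' - 2 * s)) := by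
      rw [eq_div_iff hD]
      linear_combination (p' - 2 * s) * e1 - p * e2
    rw [this]
    exact div_mem (sub_mem (mul_mem (neg_mem (natK _)) (natK _)) (mul_mem (sub_mem (natK _) (mul_mem h2K hsK)) (sub_mem hsK (natK _)))) hDK
  have sAB := h.signS K f f1 fm haK hbK 0 s hs0 hsK hs2
  have hLK : 2 * s * a ∈ K := mul_mem (mul_mem h2K hsK) haK
  have sBC := h.signS K f f1 fm haK hbK 1 (2*s*a) hL hLK hBC2
  rw [fs] at sAB
  have hr : r = 0 := by
    by_contra hr
    obtain ⟨i, hi⟩ := x00 hr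
    have := sAB i 0 hi
    rw [show ls a b 0 = 1 from rfl, f1] at this
    linarith
  have hp : p ≠ 0 := by
    rcases cB with h1 | h1
    · exact h1
    · exact absurd hr h1
  have hq : q ≠ 0 := by
    rcases cA with h1 | h1
    · exact h1
    · exact absurd hr h1
  have fa : f a < 0 := by
    obtain ⟨i, hi⟩ := x01 hp
    have := sAB i 1 hi
    rw [show ls a b 1 = a from rfl] at this
    nlinarith
  have fb : f b < 0 := by
    obtain ⟨i, hi⟩ := x02 hq
    have := sAB i 2 hi
    rw [show ls a b 2 = b from rfl] at this
    nlinarith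
  have f2 : f 2 = 2 := by
    rw [show (2:ℝ) = 1 + 1 by norm_num, map_add, f1]
  have fL : 0 < f (2 * s * a) := by
    rw [fm _ (mul_mem h2K hsK), fm _ h2K, fs, f2]
    nlinarith
  have hp' : p' = 0 := by
    by_contra hc
    obtain ⟨i, hi⟩ := x11 hc
    have := sBC i 1 hi
    rw [show ls a b 1 = a from rfl] at this
    nlinarith
  have hq' : q' = 0 := by
    by_contra hc
    obtain ⟨i, hi⟩ := x12 hc
    have := sBC i 2 hi
    rw [show ls a b 2 = b from rfl] at this
    nlinarith
  subst hr; subst hp'; subst hq'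
  push_cast at e1 e2
  have fin : 2 * (N:ℝ) * q^2 = (q * r')^2 + (N - p * r')^2 := by
    have t1 : 2 * s * (q * b) = N - p * r' := by rw [hN2]; linear_combination -2*s*e1 - p * e2
    rw [← t1]
    have t2 : (q:ℝ) * r' = 2 * s * a * q := by linear_combination -q * e2
    rw [t2, hN2]
    linear_combination -4 * s^2 * q^2 * h.sq
  right; left
  have fin' : 2 * N * q^2 = (q * r')^2 + ((N - p * r' : ℤ).natAbs)^2 := by
    zify
    rw [sq_abs]
    exact_mod_cast fin
  exact sum_sq_of N q _ _ (by have : N ≠ 0 := by rintro rfl; simp at hNpos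
                              exact this) hq fin'

lemma Good.main (h : Good N ABC τ a b) : Concl N := by
  obtain ⟨x, hx, hc⟩ := h.combi
  have h' := h.swap
  have hx' : arcsin b = π / 2 * (1 - x) := by rw [h.swap_arc, hx]; ring
  rcases hc with e | e | e | e | e | e | e | e | e | e | e
  · exact h.sp4 (by rw [hx, e])
  · exact h.sp6 (by rw [hx, e])
  · exact h'.sp6 (by rw [hx', e]; norm_num)
  · exact h.sp8 (by rw [hx, e])
  · exact h'.sp8 (by rw [hx', e]; norm_num)
  · exact h.sp10 (by rw [hx, e])
  · exact h.sp5 (by rw [hx, e])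
  · exact h'.sp5 (by rw [hx', e]; norm_num)
  · exact h'.sp10 (by rw [hx', e]; norm_num)
  · exact h.generic e
  · have c0 : ∀ z, pc (fun i => sw (τ i)) 0 z = pc τ 1 z := fun z => rfl
    have c1 : ∀ z, pc (fun i => sw (τ i)) 1 z = pc τ 0 z := fun z => rfl
    have c2 : ∀ z, pc (fun i => sw (τ i)) 2 z = pc τ 2 z := fun z => rfl
    apply h'.generic
    simp only [c0, c1, c2]
    tauto

end

section
open EuclideanGeometry Real
open scoped Topology
variable {N : ℕ} {ABC : Tri} {τ : Fin N → Tri} {a b : ℝ}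

lemma nsq_dist (u v : Pt) : nsq (u - v) = dist u v ^ 2 := by
  rw [EuclideanSpace.dist_eq, sq_sqrt (by positivity), Fin.sum_univ_two, Real.dist_eq, Real.dist_eq, _root_.sq_abs, _root_.sq_abs]
  simp [nsq]

lemma triSet_range (S T : Tri) (h : Set.range S = Set.range T) : triSet S = triSet T := by
  unfold triSet; rw [h]

open scoped Pointwise in
lemma triSet_smul (c : ℝ) (T : Tri) : triSet (fun j => c • T j) = c • triSet T := by
  unfold triSet
  rw [← convexHull_smul]
  congr 1
  ext z
  simp only [Set.mem_range, Set.mem_smul_set]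
  constructor
  · rintro ⟨j, rfl⟩; exact ⟨T j, ⟨j, rfl⟩, rfl⟩
  · rintro ⟨_, ⟨j, rfl⟩, rfl⟩; exact ⟨j, rfl⟩

lemma perm_tri (T : Tri) (h : IsTriangle T) (σ : Equiv.Perm (Fin 3)) : IsTriangle (fun j => T (σ j)) :=
  AffineIndependent.comp_embedding σ.toEmbedding h

lemma perm_range (T : Tri) (σ : Equiv.Perm (Fin 3)) : Set.range (fun j => T (σ j)) = Set.range T :=
  σ.surjective.range_comp T

lemma relabel (T : Tri) (h : IsTriangle T) (hi : IsIsosceles T) :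
    ∃ S : Tri, Set.range S = Set.range T ∧ 0 < ar S ∧ dist (S 1) (S 0) = dist (S 2) (S 0) := by
  have step : ∃ S : Tri, Set.range S = Set.range T ∧ IsTriangle S ∧ dist (S 1) (S 0) = dist (S 2) (S 0) := by
    rcases hi with e | e | e
    · exact ⟨T, rfl, h, by rw [dist_comm, e, dist_comm]⟩
    · refine ⟨fun j => T (Equiv.swap 0 1 j), perm_range _ _, perm_tri _ h _, ?_⟩
      show dist (T 0) (T 1) = dist (T 2) (T 1)
      rw [e, dist_comm]
    · refine ⟨fun j => T (Equiv.swap 0 2 j), perm_range _ _, perm_tri _ h _, ?_⟩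
      show dist (T 1) (T 2) = dist (T 0) (T 2)
      rw [e]
  obtain ⟨S, hr, hS, hd⟩ := step
  rcases lt_or_gt_of_ne (ar_ne_zero S hS) with hn | hp
  · refine ⟨fun j => S (Equiv.swap 1 2 j), (perm_range _ _).trans hr, ?_, hd.symm⟩
    have : ar (fun j => S (Equiv.swap 1 2 j)) = - ar S := by
      show cr (S 2 - S 0) (S 1 - S 0) = - cr (S 1 - S 0) (S 2 - S 0)
      simp [cr]; ring
    rw [this]; linarith
  · exact ⟨S, hr, hp, hd⟩

open scoped Pointwise in
lemma reduce (N : ℕ) (ABC T : Tri)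
    (hABC : IsTriangle ABC) (hT : IsTriangle T)
    (hiso : IsIsosceles ABC)
    (hright : ∃ k : Fin 3, triAngle T k = π / 2)
    (tiles : Fin N → Tri) (ht : IsTiling N ABC T tiles) : Concl N := by
  obtain ⟨k, hk⟩ := hright
  obtain ⟨S, hSr, hSp, hSi⟩ := relabel ABC hABC hiso
  choose σ hσ using ht.congr
  set c := dist (T (k+1)) (T (k+2)) with hc
  set a' := dist (T (k+2)) (T k) with ha'
  set b' := dist (T (k+1)) (T k) with hb'
  have hpy : c^2 = b'^2 + a'^2 := by
    have := (dist_sq_eq_dist_sq_add_dist_sq_iff_angle_eq_pi_div_two (T (k+1)) (T k) (T (k+2))).mpr hk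
    rw [hc, hb', ha']; linarith
  have inj : Function.Injective T := AffineIndependent.injective hT
  have hne1 : k + 1 ≠ k + 2 := by fin_cases k <;> decide
  have hne2 : k + 2 ≠ k := by fin_cases k <;> decide
  have hne3 : k + 1 ≠ k := by fin_cases k <;> decide
  have cpos : 0 < c := dist_pos.mpr (fun e => hne1 (inj e))
  have apos : 0 < a' := dist_pos.mpr (fun e => hne2 (inj e))
  have bpos : 0 < b' := dist_pos.mpr (fun e => hne3 (inj e))
  let ρ : Equiv.Perm (Fin 3) := Equiv.addLeft (k+1)
  let τ0 : Fin N → Tri := fun i j => tiles i ((σ i).symm (ρ j))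
  have τr : ∀ i, triSet (τ0 i) = triSet (tiles i) := fun i =>
    triSet_range _ _ (perm_range (tiles i) (ρ.trans (σ i).symm))
  have τd : ∀ i x y, dist (τ0 i x) (τ0 i y) = dist (T (k+1+x)) (T (k+1+y)) := by
    intro i x y
    show dist (tiles i ((σ i).symm (ρ x))) (tiles i ((σ i).symm (ρ y))) = _
    rw [hσ i, Equiv.apply_symm_apply, Equiv.apply_symm_apply]
    rfl
  have cinv : c⁻¹ ≠ 0 := inv_ne_zero cpos.ne'
  have nd : ∀ u v : Pt, nsq (c⁻¹ • u - c⁻¹ • v) = (dist u v / c)^2 := by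
    intro u v
    rw [← smul_sub, nsq_smul, nsq_dist]; field_simp
  have good : Good N (fun j => c⁻¹ • S j) (fun i j => c⁻¹ • τ0 i j) (a'/c) (b'/c) := by
    refine ⟨?_, div_pos apos cpos, div_pos bpos cpos, ?_, ?_, ?_, ?_, ?_⟩
    · have : ar (fun j => c⁻¹ • S j) = c⁻¹ * (c⁻¹ * ar S) := by
        unfold ar
        rw [← smul_sub, ← smul_sub, cr_smul_left, cr_smul_right]
      rw [this]; positivity
    · field_simp; linarith
    · intro i j
      show nsq (c⁻¹ • τ0 i (j+1) - c⁻¹ • τ0 i j) = _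
      rw [nd, τd]
      congr 1
      fin_cases j
      · show dist (T (k+1+1)) (T (k+1+0)) / c = 1
        rw [show k+1+1 = k+2 by fin_cases k <;> decide, show k+1+0 = k+1 by fin_cases k <;> decide, dist_comm, ← hc, div_self cpos.ne']
      · show dist (T (k+1+2)) (T (k+1+1)) / c = a' / c
        rw [show k+1+1 = k+2 by fin_cases k <;> decide, show k+1+2 = k by fin_cases k <;> decide, dist_comm]
      · show dist (T (k+1+0)) (T (k+1+2)) / c = b' / c
        rw [show k+1+0 = k+1 by fin_cases k <;> decide, show k+1+2 = k by fin_cases k <;> decide]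
    · intro i j hij
      rw [triSet_smul, triSet_smul, interior_smul₀ cinv, interior_smul₀ cinv, ← Set.smul_set_inter₀ cinv, τr, τr, ht.disj i j hij, Set.smul_set_empty]
    · simp only [triSet_smul, τr]
      rw [← Set.smul_set_iUnion, ht.cover, triSet_range S ABC hSr]
    · show nsq (c⁻¹ • S 1 - c⁻¹ • S 0) = nsq (c⁻¹ • S 2 - c⁻¹ • S 0)
      rw [nd, nd, hSi]
  exact good.main

end

/-- If an isosceles triangle `ABC` is `N`-tiled by a tile one of whose angles
is a right angle, then `N` is a perfect square, or a sum of two perfect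
squares, or six times a perfect square. -/
theorem isosceles_tiled_by_right_tile (N : ℕ) (ABC T : Tri)
    (hABC : IsTriangle ABC) (hT : IsTriangle T)
    (hiso : IsIsosceles ABC)
    (hright : ∃ k : Fin 3, triAngle T k = π / 2)
    (tiles : Fin N → Tri) (ht : IsTiling N ABC T tiles) :
    (∃ n : ℕ, N = n ^ 2) ∨ (∃ e f : ℕ, N = e ^ 2 + f ^ 2) ∨ (∃ n : ℕ, N = 6 * n ^ 2) := by
  exact reduce N ABC T hABC hT hiso hright tiles ht
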